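/- arXiv:2208.09726 — 2 statements merged into one kernel-verified Lean document; each statement's English description precedes it below -/
import Mathlib

section
/- Let (Ω, Σ, μ) be a probability space and let (f_n)_{n≥1} be any sequence of non-negative real-valued random variables on Ω. Then there exist a measurable function f : Ω → [0, +∞] and a strictly increasing map φ : ℕ → ℕ such that, setting g_n = f_{φ(n)}, for every bijection π : ℕ → ℕ the Cesàro means (1/n) ∑_{k=1}^n g_{π(k)}(ω) converge to f(ω) in [0, +∞] for μ-almost every ω ∈ Ω. -/
open MeasureTheory Filter Topology

section

variable {Ω : Type*} [MeasurableSpace Ω]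

/-- Weak limits respect the pointwise order. -/
theorem ae_le_of_tendsto_integral_mul {μ : Measure Ω} [IsFiniteMeasure μ] {U : Filter ℕ} [U.NeBot]
    {u v : ℕ → Ω → ℝ} {a b : Ω → ℝ} (hu : ∀ n, Integrable (u n) μ) (hv : ∀ n, Integrable (v n) μ)
    (ha : Integrable a μ) (hb : Integrable b μ) (huv : ∀ n ω, u n ω ≤ v n ω)
    (hua : ∀ w : Ω → ℝ, Measurable w → (∃ B, ∀ ω, |w ω| ≤ B) →
      Tendsto (fun n => ∫ ω, u n ω * w ω ∂μ) U (𝓝 (∫ ω, a ω * w ω ∂μ)))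
    (hvb : ∀ w : Ω → ℝ, Measurable w → (∃ B, ∀ ω, |w ω| ≤ B) →
      Tendsto (fun n => ∫ ω, v n ω * w ω ∂μ) U (𝓝 (∫ ω, b ω * w ω ∂μ))) :
    ∀ᵐ ω ∂μ, a ω ≤ b ω := by
  refine ae_le_of_forall_setIntegral_le ha hb fun s hs _ => ?_
  have key : ∀ g : Ω → ℝ, ∫ ω, g ω * s.indicator 1 ω ∂μ = ∫ ω in s, g ω ∂μ := fun g => by
    rw [← integral_indicator hs]
    congr 1; ext ω; by_cases h : ω ∈ s <;> simp [h]
  have hm : Measurable (s.indicator (1 : Ω → ℝ)) := measurable_one.indicator hs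
  have hB : ∃ B : ℝ, ∀ ω, |s.indicator (1 : Ω → ℝ) ω| ≤ B :=
    ⟨1, fun ω => by by_cases h : ω ∈ s <;> simp [h]⟩
  have h1 := hua _ hm hB
  have h2 := hvb _ hm hB
  simp only [key] at h1 h2
  exact le_of_tendsto_of_tendsto' h1 h2 fun n =>
    integral_mono (hu n).integrableOn (hv n).integrableOn (huv n)

/-- A bounded sequence of random variables has a weak limit along any ultrafilter, and this limit
obeys the same bounds. -/
theorem exists_weak_limit_of_bounded (μ : Measure Ω) [IsFiniteMeasure μ] (U : Ultrafilter ℕ)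
    {f : ℕ → Ω → ℝ} (hf : ∀ n, Measurable (f n)) {C : ℝ} (h0 : ∀ n ω, 0 ≤ f n ω)
    (hC : ∀ n ω, f n ω ≤ C) :
    ∃ a : Ω → ℝ, Measurable a ∧ (∀ ω, 0 ≤ a ω) ∧ (∀ ω, a ω ≤ C) ∧
      ∀ w : Ω → ℝ, Measurable w → (∃ B, ∀ ω, |w ω| ≤ B) →
        Tendsto (fun n => ∫ ω, f n ω * w ω ∂μ) U (𝓝 (∫ ω, a ω * w ω ∂μ)) := by
  rcases isEmpty_or_nonempty Ω with hΩ | ⟨⟨ω₀⟩⟩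
  · exact ⟨f 0, hf 0, h0 0, hC 0, fun w _ _ => by simp [integral_of_isEmpty]⟩
  have hC0 : 0 ≤ C := (h0 0 ω₀).trans (hC 0 ω₀)
  have hLp : ∀ n, MemLp (f n) 2 μ := fun n =>
    MemLp.of_bound (hf n).aestronglyMeasurable C
      (ae_of_all _ fun ω => by rw [Real.norm_of_nonneg (h0 n ω)]; exact hC n ω)
  set v : ℕ → Lp ℝ 2 μ := fun n => (hLp n).toLp (f n) with hv
  obtain ⟨R, hR⟩ : ∃ R, ∀ n, ‖v n‖ ≤ R := by
    refine ⟨μ.real Set.univ ^ ((2 : ENNReal).toReal⁻¹) * C, fun n => ?_⟩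
    refine Lp.norm_le_of_ae_bound hC0 ?_
    filter_upwards [(hLp n).coeFn_toLp] with ω hω
    rw [hω, Real.norm_of_nonneg (h0 n ω)]
    exact hC n ω
  set d : ℕ → WeakDual ℝ (Lp ℝ 2 μ) := fun n =>
    StrongDual.toWeakDual (InnerProductSpace.toDual ℝ (Lp ℝ 2 μ) (v n)) with hd
  obtain ⟨x, -, hx⟩ := (WeakDual.isCompact_closedBall (𝕜 := ℝ) (E := Lp ℝ 2 μ) 0 R)
    |>.ultrafilter_le_nhds' (U.map d) (by
      refine Filter.Eventually.of_forall (f := (U : Filter ℕ)) fun n => ?_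
      simpa [hd] using hR n)
  obtain ⟨y, hy⟩ := (InnerProductSpace.toDual ℝ (Lp ℝ 2 μ)).surjective (WeakDual.toStrongDual x)
  have hlim : ∀ w : Ω → ℝ, Measurable w → (∃ B, ∀ ω, |w ω| ≤ B) →
      Tendsto (fun n => ∫ ω, f n ω * w ω ∂μ) U (𝓝 (∫ ω, y ω * w ω ∂μ)) := by
    rintro w hw ⟨B, hB⟩
    have hwLp : MemLp w 2 μ := MemLp.of_bound hw.aestronglyMeasurable B (ae_of_all _ hB)
    have h1 : Tendsto (fun n => d n (hwLp.toLp w)) U (𝓝 (x (hwLp.toLp w))) :=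
      ((WeakDual.eval_continuous (hwLp.toLp w)).tendsto x).comp hx
    have h2 : x (hwLp.toLp w) = ∫ ω, y ω * w ω ∂μ := by
      have : x (hwLp.toLp w) = inner ℝ y (hwLp.toLp w) := by
        rw [← InnerProductSpace.toDual_apply_apply (𝕜 := ℝ), hy]; rfl
      rw [this, L2.inner_def]
      refine integral_congr_ae ?_
      filter_upwards [hwLp.coeFn_toLp] with ω hω
      simp [hω, mul_comm]
    have h3 : ∀ n, d n (hwLp.toLp w) = ∫ ω, f n ω * w ω ∂μ := fun n => by
      have : d n (hwLp.toLp w) = inner ℝ (v n) (hwLp.toLp w) := by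
        rw [← InnerProductSpace.toDual_apply_apply (𝕜 := ℝ)]; rfl
      rw [this, L2.inner_def]
      refine integral_congr_ae ?_
      filter_upwards [hwLp.coeFn_toLp, (hLp n).coeFn_toLp] with ω hω hω'
      simp [hω, hω', hv, mul_comm]
    simpa only [h2, h3] using h1
  have hyint : Integrable y μ := (Lp.memLp y).integrable (by norm_num)
  have hfint : ∀ n, Integrable (f n) μ := fun n => (hLp n).integrable (by norm_num)
  have hy0 : ∀ᵐ ω ∂μ, 0 ≤ y ω :=
    ae_le_of_tendsto_integral_mul (fun _ => integrable_zero _ _ _) hfint (integrable_zero _ _ _)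
      hyint h0 (fun _ _ _ => tendsto_const_nhds) hlim
  have hyC : ∀ᵐ ω ∂μ, y ω ≤ C :=
    ae_le_of_tendsto_integral_mul hfint (fun _ => integrable_const C) hyint (integrable_const C)
      hC hlim fun _ _ _ => tendsto_const_nhds
  refine ⟨fun ω => max 0 (min (y ω) C), ?_, fun ω => le_max_left _ _,
    fun ω => max_le hC0 (min_le_right _ _), fun w hw hB => ?_⟩
  · exact measurable_const.max ((Lp.stronglyMeasurable y).measurable.min measurable_const)
  · convert hlim w hw hB using 2
    refine integral_congr_ae ?_
    filter_upwards [hy0, hyC] with ω h1 h2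
    simp [min_eq_left h2, max_eq_right h1]

/-- Recursive choice of a subsequence whose `n`-th term is adapted to `n` and the previous term. -/
theorem exists_strictMono_of_forall_exists_gt {P : ℕ → ℕ → ℕ → Prop}
    (h : ∀ n p, ∃ i > p, P n p i) :
    ∃ φ : ℕ → ℕ, StrictMono φ ∧ ∀ n, ∃ p, (∀ m < n, φ m ≤ p) ∧ P n p (φ n) := by
  choose c hc hP using h
  let φ : ℕ → ℕ := fun n => Nat.rec (c 0 0) (fun k p => c (k + 1) p) n
  have hφ : StrictMono φ := strictMono_nat_of_lt_succ fun n => hc (n + 1) (φ n)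
  refine ⟨φ, hφ, fun n => ?_⟩
  cases n with
  | zero => exact ⟨0, by simp, hP 0 0⟩
  | succ n => exact ⟨φ n, fun m hm => hφ.monotone (Nat.lt_succ_iff.1 hm), hP (n + 1) (φ n)⟩

/-- The truncations of `g` fluctuate around `a` in an almost uncorrelated way. -/
def AlmostUncorrelated (ν : Measure Ω) (g a : ℕ → Ω → ℝ) : Prop :=
  (∀ n, ∀ k : ℕ, k ≤ 2 ^ n → |∫ ω, (min (g n ω) k - a k ω) ∂ν| ≤ (1 / 4) ^ n) ∧
  ∀ n, ∀ m < n, ∀ k l : ℕ, k ≤ 2 ^ n → l ≤ 2 ^ n →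
    |∫ ω, (min (g n ω) k - a k ω) * (min (g m ω) l - a l ω) ∂ν| ≤ (1 / 4) ^ n

theorem abs_min_sub_le {x c a : ℝ} (hx : 0 ≤ x) (hc : 0 ≤ c) (ha : 0 ≤ a) (hac : a ≤ c) :
    |min x c - a| ≤ c :=
  abs_sub_le_of_nonneg_of_le (le_min hx hc) (min_le_right _ _) ha hac

theorem integrable_of_measurable_of_abs_le {ν : Measure Ω} [IsFiniteMeasure ν] {h : Ω → ℝ} {B : ℝ}
    (hm : Measurable h) (hB : ∀ ω, |h ω| ≤ B) : Integrable h ν :=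
  Integrable.of_bound hm.aestronglyMeasurable B (ae_of_all _ hB)

theorem eventually_almost_uncorrelated {ν : Measure Ω} [IsFiniteMeasure ν] {U : Filter ℕ}
    {f a : ℕ → Ω → ℝ} (hf : ∀ n, Measurable (f n)) (hf0 : ∀ n ω, 0 ≤ f n ω)
    (ha : ∀ k, Measurable (a k)) (ha0 : ∀ k ω, 0 ≤ a k ω) (hak : ∀ k ω, a k ω ≤ k)
    (hlim : ∀ (k : ℕ) (w : Ω → ℝ), Measurable w → (∃ B, ∀ ω, |w ω| ≤ B) →
      Tendsto (fun n => ∫ ω, min (f n ω) k * w ω ∂ν) U (𝓝 (∫ ω, a k ω * w ω ∂ν)))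
    (K p : ℕ) {ε : ℝ} (hε : 0 < ε) :
    ∀ᶠ i in U, (∀ k ≤ K, |∫ ω, (min (f i ω) k - a k ω) ∂ν| ≤ ε) ∧
      ∀ q ≤ p, ∀ k ≤ K, ∀ l ≤ K,
        |∫ ω, (min (f i ω) k - a k ω) * (min (f q ω) l - a l ω) ∂ν| ≤ ε := by
  have key : ∀ (k : ℕ) (w : Ω → ℝ), Measurable w → (∃ B, ∀ ω, |w ω| ≤ B) →
      ∀ᶠ i in U, |∫ ω, (min (f i ω) k - a k ω) * w ω ∂ν| ≤ ε := by
    rintro k w hw ⟨B, hB⟩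
    filter_upwards [(tendsto_order.1 (tendsto_iff_dist_tendsto_zero.1 (hlim k w hw ⟨B, hB⟩))).2
      ε hε] with i hi
    rw [Real.dist_eq] at hi
    refine le_of_eq_of_le ?_ hi.le
    have hb : ∀ h : Ω → ℝ, Measurable h → (∀ ω, 0 ≤ h ω) → (∀ ω, h ω ≤ k) →
        Integrable (fun ω => h ω * w ω) ν := fun h hm h0 hk =>
      integrable_of_measurable_of_abs_le (B := k * B) (hm.mul hw) fun ω => by
        rw [abs_mul, abs_of_nonneg (h0 ω)]
        exact mul_le_mul (hk ω) (hB ω) (abs_nonneg _) (Nat.cast_nonneg k)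
    rw [← integral_sub (hb _ ((hf i).min measurable_const)
      (fun ω => le_min (hf0 i ω) (Nat.cast_nonneg k)) fun ω => min_le_right _ _)
      (hb _ (ha k) (ha0 k) (hak k))]
    simp only [sub_mul]
  refine Filter.Eventually.and ?_ ?_
  · refine (Set.finite_Iic K).eventually_all.2 fun k _ => ?_
    simpa using key k 1 measurable_one ⟨1, by simp⟩
  · refine (Set.finite_Iic p).eventually_all.2 fun q _ =>
      (Set.finite_Iic K).eventually_all.2 fun k _ =>
      (Set.finite_Iic K).eventually_all.2 fun l _ => ?_
    exact key k _ (((hf q).min measurable_const).sub (ha l))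
      ⟨l, fun ω => abs_min_sub_le (hf0 q ω) (Nat.cast_nonneg l) (ha0 l ω) (hak l ω)⟩

theorem ae_tendsto_zero_of_summable_integral {ν : Measure Ω} {h : ℕ → Ω → ℝ}
    (hm : ∀ i, Measurable (h i)) (hint : ∀ i, Integrable (h i) ν) (h0 : ∀ i ω, 0 ≤ h i ω)
    (hs : Summable fun i => ∫ ω, h i ω ∂ν) :
    ∀ᵐ ω ∂ν, Tendsto (fun i => h i ω) atTop (𝓝 0) := by
  have hfin : ∫⁻ ω, ∑' i, ENNReal.ofReal (h i ω) ∂ν ≠ ⊤ := by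
    rw [lintegral_tsum fun i => (hm i).ennreal_ofReal.aemeasurable]
    simp_rw [← fun i => ofReal_integral_eq_lintegral_ofReal (hint i) (ae_of_all _ (h0 i))]
    exact hs.tsum_ofReal_ne_top
  filter_upwards [ae_lt_top (Measurable.tsum fun i => (hm i).ennreal_ofReal) hfin] with ω hω
  have h1 := ENNReal.tendsto_atTop_zero_of_tsum_ne_top hω.ne
  have h2 := (ENNReal.continuousAt_toReal ENNReal.zero_ne_top).tendsto.comp h1
  simpa [Function.comp_def, ENNReal.toReal_ofReal (h0 _ ω)] using h2

theorem summable_sum_range_div_sq_floor_pow {v : ℕ → ℝ} (hv : ∀ k, 0 ≤ v k)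
    (hs : Summable fun k : ℕ => v k / ((k : ℝ) + 1) ^ 2) {c : ℝ} (hc : 1 < c) :
    Summable fun i : ℕ => (∑ k ∈ Finset.range ⌊c ^ i⌋₊, v k) / (⌊c ^ i⌋₊ : ℝ) ^ 2 := by
  set C : ℝ := c ^ 5 * (c - 1)⁻¹ ^ 3
  have hC : 0 ≤ C := by have := sub_pos.2 hc; positivity
  refine summable_of_sum_range_le (c := ∑' k : ℕ, 4 * C * (v k / ((k : ℝ) + 1) ^ 2))
    (fun i => div_nonneg (Finset.sum_nonneg fun k _ => hv k) (sq_nonneg _)) fun I => ?_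
  set N : ℕ → ℕ := fun i => ⌊c ^ i⌋₊
  obtain ⟨M, hM⟩ : ∃ M, ∀ i ∈ Finset.range I, N i ≤ M :=
    ⟨(Finset.range I).sup N, fun i hi => Finset.le_sup hi⟩
  calc ∑ i ∈ Finset.range I, (∑ k ∈ Finset.range (N i), v k) / (N i : ℝ) ^ 2
      = ∑ i ∈ Finset.range I, ∑ k ∈ Finset.range M,
          if k < N i then v k * (1 / (N i : ℝ) ^ 2) else 0 := by
        refine Finset.sum_congr rfl fun i hi => ?_
        rw [← Finset.sum_filter, Finset.sum_div]
        refine Finset.sum_congr ?_ fun k _ => by ring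
        ext k
        have := hM i hi
        simp only [Finset.mem_range, Finset.mem_filter]
        omega
    _ = ∑ k ∈ Finset.range M, v k *
          ∑ i ∈ Finset.range I with ((k : ℝ) + 1 / 2) < N i, 1 / (N i : ℝ) ^ 2 := by
        rw [Finset.sum_comm]
        refine Finset.sum_congr rfl fun k _ => ?_
        rw [Finset.mul_sum, Finset.sum_filter]
        refine Finset.sum_congr rfl fun i _ => ?_
        have : k < N i ↔ ((k : ℝ) + 1 / 2) < N i := by
          constructor
          · intro h
            have : ((k + 1 : ℕ) : ℝ) ≤ N i := by exact_mod_cast h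
            push_cast at this
            linarith
          · intro h
            have : (k : ℝ) < N i := by linarith
            exact_mod_cast this
        simp only [this]
    _ ≤ ∑ k ∈ Finset.range M, 4 * C * (v k / ((k : ℝ) + 1) ^ 2) := by
        refine Finset.sum_le_sum fun k _ => ?_
        have hk : (0 : ℝ) < (k : ℝ) + 1 / 2 := by positivity
        calc _ ≤ v k * (C / ((k : ℝ) + 1 / 2) ^ 2) :=
              mul_le_mul_of_nonneg_left (sum_div_nat_floor_pow_sq_le_div_sq I hk hc) (hv k)
          _ ≤ v k * (C / (((k : ℝ) + 1) / 2) ^ 2) := by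
              have := hv k
              gcongr
              linarith [(Nat.cast_nonneg k : (0 : ℝ) ≤ k)]
          _ = _ := by field_simp; ring
    _ ≤ _ := (hs.mul_left _).sum_le_tsum _ fun k _ =>
        mul_nonneg (by positivity) (div_nonneg (hv k) (sq_nonneg _))

theorem integral_sq_sum_range_le {ν : Measure Ω} [IsFiniteMeasure ν] {Z : ℕ → Ω → ℝ} {δ : ℕ → ℝ}
    (hZ : ∀ k, Measurable (Z k)) (hB : ∀ k, ∃ B, ∀ ω, |Z k ω| ≤ B)
    (hδ0 : ∀ k, 0 ≤ δ k) (hδ : Summable δ)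
    (hcross : ∀ k l, k ≠ l → ∫ ω, Z k ω * Z l ω ∂ν ≤ δ k * δ l) (N : ℕ) :
    ∫ ω, (∑ k ∈ Finset.range N, Z k ω) ^ 2 ∂ν ≤
      ∑ k ∈ Finset.range N, ∫ ω, Z k ω ^ 2 ∂ν + (∑' k, δ k) ^ 2 := by
  choose B hB using hB
  have hint : ∀ k l, Integrable (fun ω => Z k ω * Z l ω) ν := fun k l =>
    integrable_of_measurable_of_abs_le (B := B k * B l) ((hZ k).mul (hZ l)) fun ω => by
      rw [abs_mul]
      exact mul_le_mul (hB k ω) (hB l ω) (abs_nonneg _) ((abs_nonneg _).trans (hB k ω))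
  simp_rw [sq (∑ k ∈ Finset.range N, Z k _), Finset.sum_mul_sum]
  rw [integral_finsetSum _ fun k _ => integrable_finsetSum _ fun l _ => hint k l]
  simp_rw [integral_finsetSum (Finset.range N) fun l _ => hint _ l]
  calc ∑ k ∈ Finset.range N, ∑ l ∈ Finset.range N, ∫ ω, Z k ω * Z l ω ∂ν
      ≤ ∑ k ∈ Finset.range N, ∑ l ∈ Finset.range N,
          ((if k = l then ∫ ω, Z k ω ^ 2 ∂ν else 0) + δ k * δ l) := by
        refine Finset.sum_le_sum fun k _ => Finset.sum_le_sum fun l _ => ?_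
        split_ifs with h
        · subst h
          simp only [sq]
          exact le_add_of_nonneg_right (mul_self_nonneg _)
        · simpa using hcross k l h
    _ = ∑ k ∈ Finset.range N, ∫ ω, Z k ω ^ 2 ∂ν + (∑ k ∈ Finset.range N, δ k) ^ 2 := by
        simp_rw [Finset.sum_add_distrib, sq (∑ k ∈ Finset.range N, δ k), Finset.sum_mul_sum,
          Finset.sum_ite_eq]
        congr 1
        exact Finset.sum_congr rfl fun k hk => by rw [if_pos hk]
    _ ≤ _ := by
        gcongr
        · exact Finset.sum_nonneg fun k _ => hδ0 k
        · exact hδ.sum_le_tsum _ fun k _ => hδ0 k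

theorem summable_const_div_succ_sq (D : ℝ) : Summable fun k : ℕ => D / ((k : ℝ) + 1) ^ 2 := by
  have := ((summable_nat_add_iff 1).2 (Real.summable_one_div_nat_pow.2 one_lt_two)).mul_left D
  simpa [mul_one_div, div_eq_mul_inv] using this

/-- **Strong law of large numbers** for non-negative random variables whose deviations from `b k`
are almost orthogonal. -/
theorem ae_tendsto_average_of_almost_orthogonal {ν : Measure Ω} [IsFiniteMeasure ν]
    {Y b : ℕ → Ω → ℝ} {β : Ω → ℝ} {δ : ℕ → ℝ} (hY : ∀ k, Measurable (Y k))
    (hb : ∀ k, Measurable (b k)) (hY0 : ∀ k ω, 0 ≤ Y k ω)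
    (hB : ∀ k, ∃ B, ∀ ω, |Y k ω - b k ω| ≤ B) (hδ0 : ∀ k, 0 ≤ δ k) (hδ : Summable δ)
    (hcross : ∀ k l, k ≠ l → ∫ ω, (Y k ω - b k ω) * (Y l ω - b l ω) ∂ν ≤ δ k * δ l)
    (hvar : Summable fun k : ℕ => (∫ ω, (Y k ω - b k ω) ^ 2 ∂ν) / ((k : ℝ) + 1) ^ 2)
    (hlim : ∀ᵐ ω ∂ν, Tendsto (fun k => b k ω) atTop (𝓝 (β ω))) :
    ∀ᵐ ω ∂ν, Tendsto (fun N : ℕ => (∑ k ∈ Finset.range N, Y k ω) / N) atTop (𝓝 (β ω)) := by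
  have hsub : ∀ c : ℝ, 1 < c → ∀ᵐ ω ∂ν, Tendsto (fun i : ℕ =>
      ((∑ k ∈ Finset.range ⌊c ^ i⌋₊, (Y k ω - b k ω)) / (⌊c ^ i⌋₊ : ℝ)) ^ 2) atTop (𝓝 0) := by
    intro c hc
    have hZ : ∀ k, Measurable fun ω => Y k ω - b k ω := fun k => (hY k).sub (hb k)
    have hm : ∀ N : ℕ, Measurable fun ω =>
        ((∑ k ∈ Finset.range N, (Y k ω - b k ω)) / (N : ℝ)) ^ 2 := fun N => by fun_prop
    refine ae_tendsto_zero_of_summable_integral (fun i => hm _) (fun i => ?_)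
      (fun i ω => sq_nonneg _) ?_
    · choose B hB using hB
      refine integrable_of_measurable_of_abs_le
        (B := ((∑ k ∈ Finset.range ⌊c ^ i⌋₊, B k) / (⌊c ^ i⌋₊ : ℝ)) ^ 2) (hm _) fun ω => ?_
      rw [abs_pow, abs_div, Nat.abs_cast]
      gcongr
      exact (Finset.abs_sum_le_sum_abs _ _).trans (Finset.sum_le_sum fun k _ => hB k ω)
    · have hD := hvar.add (summable_const_div_succ_sq ((∑' k, δ k) ^ 2))
      simp_rw [← add_div] at hD
      refine Summable.of_nonneg_of_le (fun i => integral_nonneg fun ω => sq_nonneg _) (fun i => ?_)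
        (summable_sum_range_div_sq_floor_pow (fun k => add_nonneg
          (integral_nonneg fun ω => sq_nonneg _) (sq_nonneg _)) hD hc)
      simp_rw [div_pow]
      rw [integral_div]
      gcongr
      refine (integral_sq_sum_range_le hZ hB hδ0 hδ hcross _).trans ?_
      rw [Finset.sum_add_distrib]
      gcongr
      have h1 : 1 ≤ ⌊c ^ i⌋₊ := Nat.le_floor (by simpa using one_le_pow₀ hc.le)
      rw [Finset.sum_const, Finset.card_range, nsmul_eq_mul]
      exact le_mul_of_one_le_left (sq_nonneg _) (by exact_mod_cast h1)
  have hcone : ∀ j : ℕ, (1 : ℝ) < 1 + 1 / ((j : ℝ) + 1) := fun j =>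
    lt_add_of_pos_right _ (by positivity)
  filter_upwards [ae_all_iff.2 fun j : ℕ => hsub _ (hcone j), hlim] with ω hω hbω
  refine tendsto_div_of_monotone_of_tendsto_div_floor_pow _ _
    (monotone_nat_of_le_succ fun N => by
      rw [Finset.sum_range_succ]; exact le_add_of_nonneg_right (hY0 N ω))
    (fun j : ℕ => 1 + 1 / ((j : ℝ) + 1)) hcone
    (by simpa using tendsto_one_div_add_atTop_nhds_zero_nat.const_add (1 : ℝ)) fun j => ?_
  have h1 : Tendsto (fun i : ℕ =>
      (∑ k ∈ Finset.range ⌊(1 + 1 / ((j : ℝ) + 1)) ^ i⌋₊, (Y k ω - b k ω)) /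
        (⌊(1 + 1 / ((j : ℝ) + 1)) ^ i⌋₊ : ℝ)) atTop (𝓝 0) := by
    rw [tendsto_zero_iff_abs_tendsto_zero]
    have := (Real.continuous_sqrt.tendsto 0).comp (hω j)
    simpa only [Function.comp_def, Real.sqrt_sq_eq_abs, Real.sqrt_zero] using this
  have h2 := hbω.cesaro.comp
    (tendsto_nat_floor_atTop.comp (tendsto_pow_atTop_atTop_of_one_lt (hcone j)))
  refine ((h1.add h2).congr fun i => ?_).trans (by simp)
  simp only [Function.comp_apply, Finset.sum_sub_distrib]
  ring

theorem AlmostUncorrelated.ae_tendsto_average_min {ν : Measure Ω} [IsFiniteMeasure ν]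
    {g a : ℕ → Ω → ℝ} (h : AlmostUncorrelated ν g a) (hg : ∀ n, Measurable (g n))
    (hg0 : ∀ n ω, 0 ≤ g n ω) (ha : ∀ k, Measurable (a k)) (ha0 : ∀ k ω, 0 ≤ a k ω)
    (hak : ∀ k ω, a k ω ≤ k) {π : ℕ → ℕ} (hπ : Function.Injective π) {t : ℕ → ℕ}
    (ht : ∀ k, t k ≤ 2 ^ π k) {β : Ω → ℝ}
    (hvar : Summable fun k : ℕ =>
      (∫ ω, (min (g (π k) ω) (t k) - a (t k) ω) ^ 2 ∂ν) / ((k : ℝ) + 1) ^ 2)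
    (hlim : ∀ᵐ ω ∂ν, Tendsto (fun k => a (t k) ω) atTop (𝓝 (β ω))) :
    ∀ᵐ ω ∂ν, Tendsto (fun N : ℕ => (∑ k ∈ Finset.range N, min (g (π k) ω) (t k)) / N)
      atTop (𝓝 (β ω)) := by
  refine ae_tendsto_average_of_almost_orthogonal (Y := fun k ω => min (g (π k) ω) (t k))
    (b := fun k => a (t k)) (δ := fun k => (1 / 2) ^ π k) (fun k => (hg _).min measurable_const)
    (fun k => ha _) (fun k ω => le_min (hg0 _ ω) (Nat.cast_nonneg _))
    (fun k => ⟨t k, fun ω => abs_min_sub_le (hg0 _ ω) (Nat.cast_nonneg _) (ha0 _ ω) (hak _ ω)⟩)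
    (fun k => by positivity) (summable_geometric_two.comp_injective hπ) ?_ hvar hlim
  have hpow : ∀ m n : ℕ, m < n → (1 / 4 : ℝ) ^ n ≤ (1 / 2) ^ m * (1 / 2) ^ n := fun m n hmn => by
    have : (1 / 4 : ℝ) ^ n = (1 / 2) ^ n * (1 / 2) ^ n := by rw [← mul_pow]; norm_num
    rw [this]
    gcongr ?_ * _
    exact pow_le_pow_of_le_one (by norm_num) (by norm_num) hmn.le
  have key : ∀ k l, π k < π l →
      ∫ ω, (min (g (π k) ω) (t k) - a (t k) ω) * (min (g (π l) ω) (t l) - a (t l) ω) ∂ν ≤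
        (1 / 2) ^ π k * (1 / 2) ^ π l := fun k l hkl => by
    have := h.2 (π l) (π k) hkl (t l) (t k) (ht l)
      ((ht k).trans (Nat.pow_le_pow_right two_pos hkl.le))
    simp_rw [mul_comm (min (g (π k) _) _ - _)]
    exact (le_abs_self _).trans (this.trans (hpow _ _ hkl))
  intro k l hkl
  rcases lt_or_gt_of_ne (hπ.ne hkl) with h1 | h1
  · exact key k l h1
  · have := key l k h1
    simp_rw [mul_comm (min (g (π l) _) _ - _)] at this
    linarith

theorem AlmostUncorrelated.ae_tendsto_average_min_const {ν : Measure Ω} [IsFiniteMeasure ν]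
    {g a : ℕ → Ω → ℝ} (h : AlmostUncorrelated ν g a) (hg : ∀ n, Measurable (g n))
    (hg0 : ∀ n ω, 0 ≤ g n ω) (ha : ∀ k, Measurable (a k)) (ha0 : ∀ k ω, 0 ≤ a k ω)
    (hak : ∀ k ω, a k ω ≤ k) {π : ℕ → ℕ} (hπ : Function.Injective π) (M : ℕ) :
    ∀ᵐ ω ∂ν, Tendsto
      (fun N : ℕ => (∑ k ∈ Finset.range N, min (g (π k) ω) (min M (2 ^ π k) : ℕ)) / N)
      atTop (𝓝 (a M ω)) := by
  refine h.ae_tendsto_average_min hg hg0 ha ha0 hak hπ (t := fun k => min M (2 ^ π k))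
    (fun k => min_le_right _ _) ?_ (ae_of_all _ fun ω => ?_)
  · refine Summable.of_nonneg_of_le (fun k => div_nonneg (integral_nonneg fun ω => sq_nonneg _)
      (sq_nonneg _)) (fun k => ?_) (summable_const_div_succ_sq (∫ _, (M : ℝ) ^ 2 ∂ν))
    refine div_le_div_of_nonneg_right (integral_mono_of_nonneg (ae_of_all _ fun ω => sq_nonneg _)
      (integrable_const _) (ae_of_all _ fun ω => ?_)) (sq_nonneg _)
    refine sq_le_sq' (neg_le_of_abs_le ?_) (le_of_abs_le ?_) <;>
    exact (abs_min_sub_le (hg0 _ ω) (Nat.cast_nonneg _) (ha0 _ ω) (hak _ ω)).trans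
      (by exact_mod_cast min_le_left _ _)
  · refine tendsto_const_nhds.congr' ?_
    filter_upwards [hπ.nat_tendsto_atTop.eventually_ge_atTop M] with k hk
    rw [min_eq_left (hk.trans Nat.lt_two_pow_self.le)]

theorem sq_min_natCast_le {x : ℝ} (hx : 0 ≤ x) (k : ℕ) :
    (min x k) ^ 2 ≤ ∑ j ∈ Finset.range k, 2 * ((j : ℝ) + 1) * (min x (j + 1 : ℕ) - min x j) := by
  induction k with
  | zero => simp [hx]
  | succ k ih =>
    rw [Finset.sum_range_succ]
    have h1 : min x (k : ℝ) ≤ k := min_le_right _ _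
    have h2 : min x ((k + 1 : ℕ) : ℝ) ≤ k + 1 := by push_cast; exact min_le_right _ _
    have h3 : min x (k : ℝ) ≤ min x ((k + 1 : ℕ) : ℝ) :=
      min_le_min_left _ (by push_cast; linarith)
    nlinarith [mul_nonneg (sub_nonneg.2 h3)
      (show 0 ≤ 2 * ((k : ℝ) + 1) - (min x ((k + 1 : ℕ) : ℝ) + min x (k : ℝ)) by linarith)]

theorem summable_sum_mul_div_succ_sq {d : ℕ → ℝ} (hd0 : ∀ j, 0 ≤ d j) (hd : Summable d) :
    Summable fun k : ℕ =>
      (∑ j ∈ Finset.range (k + 1), 2 * ((j : ℝ) + 1) * d j) / ((k : ℝ) + 1) ^ 2 := by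
  set W : ℕ → ℝ := fun N => ∑ j ∈ Finset.range N, 2 * ((j : ℝ) + 1) * d j with hW
  have hW0 : ∀ N, 0 ≤ W N := fun N =>
    Finset.sum_nonneg fun j _ => mul_nonneg (by positivity) (hd0 j)
  have key : ∀ N : ℕ, ∑ k ∈ Finset.range N, W (k + 1) / ((k : ℝ) + 1) ^ 2 + 2 * W N / ((N : ℝ) + 1)
      ≤ 4 * ∑ j ∈ Finset.range N, d j := by
    intro N
    induction N with
    | zero => simp [hW]
    | succ N ih =>
      rw [Finset.sum_range_succ, Finset.sum_range_succ d]
      have e : W (N + 1) = W N + 2 * ((N : ℝ) + 1) * d N := Finset.sum_range_succ _ _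
      have h1 : 2 * W N / ((N : ℝ) + 1) = 2 * W (N + 1) / ((N : ℝ) + 1) - 4 * d N := by
        rw [e]; field_simp; ring
      have h2 : W (N + 1) / ((N : ℝ) + 1) ^ 2 + 2 * W (N + 1) / ((N : ℝ) + 1 + 1) ≤
          2 * W (N + 1) / ((N : ℝ) + 1) := by
        rw [← sub_nonneg]
        have : 2 * W (N + 1) / ((N : ℝ) + 1) - (W (N + 1) / ((N : ℝ) + 1) ^ 2 +
            2 * W (N + 1) / ((N : ℝ) + 1 + 1)) =
            W (N + 1) * (N / (((N : ℝ) + 1) ^ 2 * ((N : ℝ) + 1 + 1))) := by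
          field_simp; ring
        rw [this]
        exact mul_nonneg (hW0 _) (by positivity)
      push_cast
      linarith
  refine summable_of_sum_range_le (c := 4 * ∑' j, d j)
    (fun k => div_nonneg (hW0 _) (sq_nonneg _)) fun N => ?_
  have h1 := key N
  have h2 : 0 ≤ 2 * W N / ((N : ℝ) + 1) := div_nonneg (mul_nonneg two_pos.le (hW0 N)) (by positivity)
  have h3 := hd.sum_le_tsum (Finset.range N) fun j _ => hd0 j
  linarith

theorem tendsto_average_of_eventually_eq {u v : ℕ → ℝ} {l : ℝ} (huv : ∀ᶠ k in atTop, u k = v k)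
    (hv : Tendsto (fun N : ℕ => (∑ k ∈ Finset.range N, v k) / N) atTop (𝓝 l)) :
    Tendsto (fun N : ℕ => (∑ k ∈ Finset.range N, u k) / N) atTop (𝓝 l) := by
  have h : Tendsto (fun k => u k - v k) atTop (𝓝 0) :=
    tendsto_const_nhds.congr' (huv.mono fun k hk => by simp [hk])
  refine ((hv.add h.cesaro).congr fun N => ?_).trans (by simp)
  rw [Finset.sum_sub_distrib]
  ring

/-- If the means `a k` increase to an integrable limit, the averages of `g ∘ π` converge. -/
theorem AlmostUncorrelated.ae_tendsto_average {ν : Measure Ω} [IsFiniteMeasure ν]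
    {g a : ℕ → Ω → ℝ} (h : AlmostUncorrelated ν g a) (hg : ∀ n, Measurable (g n))
    (hg0 : ∀ n ω, 0 ≤ g n ω) (ha : ∀ k, Measurable (a k)) (ha0 : ∀ k ω, 0 ≤ a k ω)
    (hak : ∀ k ω, a k ω ≤ k) (hmono : ∀ᵐ ω ∂ν, Monotone fun k => a k ω) {C : ℝ}
    (hC1 : ∀ k, ∫ ω, a k ω ∂ν ≤ C) (hC2 : ∀ k, ∫ ω, a k ω ^ 2 ∂ν ≤ C) {β : Ω → ℝ}
    (hlim : ∀ᵐ ω ∂ν, Tendsto (fun k => a k ω) atTop (𝓝 (β ω)))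
    {π : ℕ → ℕ} (hπ : Function.Injective π) :
    ∀ᵐ ω ∂ν, Tendsto (fun N : ℕ => (∑ k ∈ Finset.range N, g (π k) ω) / N) atTop (𝓝 (β ω)) := by
  have hai : ∀ k, Integrable (a k) ν := fun k =>
    integrable_of_measurable_of_abs_le (ha k) fun ω => by rw [abs_of_nonneg (ha0 k ω)]; exact hak k ω
  have hgi : ∀ n k : ℕ, Integrable (fun ω => min (g n ω) k) ν := fun n k =>
    integrable_of_measurable_of_abs_le (B := k) ((hg n).min measurable_const) fun ω => by
      rw [abs_of_nonneg (le_min (hg0 n ω) (Nat.cast_nonneg k))]; exact min_le_right _ _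
  have hdiff : ∀ n k : ℕ, k ≤ 2 ^ n →
      |∫ ω, min (g n ω) k ∂ν - ∫ ω, a k ω ∂ν| ≤ (1 / 4) ^ n := fun n k hk => by
    rw [← integral_sub (hgi n k) (hai k)]; exact h.1 n k hk
  set d : ℕ → ℝ := fun j => ∫ ω, a (j + 1) ω ∂ν - ∫ ω, a j ω ∂ν with hd_def
  have hd0 : ∀ j, 0 ≤ d j := fun j => sub_nonneg.2 <|
    integral_mono_ae (hai j) (hai (j + 1)) (hmono.mono fun ω hω => hω (Nat.le_succ j))
  have hd : Summable d := summable_of_sum_range_le (c := C) hd0 fun N => by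
    rw [Finset.sum_range_sub (fun j => ∫ ω, a j ω ∂ν)]
    linarith [hC1 N, integral_nonneg (μ := ν) (f := a 0) (ha0 0)]
  have hq : Summable fun k => (1 / 4 : ℝ) ^ π k :=
    (summable_geometric_of_lt_one (by norm_num) (by norm_num)).comp_injective hπ
  have hlayer : ∀ n j : ℕ, j + 1 ≤ 2 ^ n →
      ∫ ω, (min (g n ω) (j + 1 : ℕ) - min (g n ω) j) ∂ν ≤ d j + 2 * (1 / 4) ^ n := fun n j hj => by
    rw [integral_sub (hgi n _) (hgi n j)]
    have h1 := abs_le.1 (hdiff n (j + 1) hj)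
    have h2 := abs_le.1 (hdiff n j (by omega))
    simp only [hd_def]
    linarith [h1.2, h2.1]
  have hmoment : ∀ n t : ℕ, t ≤ 2 ^ n → ∫ ω, (min (g n ω) t) ^ 2 ∂ν ≤
      ∑ j ∈ Finset.range t, 2 * ((j : ℝ) + 1) * (d j + 2 * (1 / 4) ^ n) := fun n t ht => by
    calc ∫ ω, (min (g n ω) t) ^ 2 ∂ν
        ≤ ∫ ω, ∑ j ∈ Finset.range t,
            2 * ((j : ℝ) + 1) * (min (g n ω) (j + 1 : ℕ) - min (g n ω) j) ∂ν :=
          integral_mono_of_nonneg (ae_of_all _ fun ω => sq_nonneg _)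
            (integrable_finsetSum _ fun j _ => ((hgi n _).sub (hgi n j)).const_mul _)
            (ae_of_all _ fun ω => sq_min_natCast_le (hg0 n ω) t)
      _ = ∑ j ∈ Finset.range t, 2 * ((j : ℝ) + 1) *
            ∫ ω, (min (g n ω) (j + 1 : ℕ) - min (g n ω) j) ∂ν := by
          rw [integral_finsetSum]
          · exact Finset.sum_congr rfl fun j _ => integral_const_mul _ _
          · exact fun j _ => ((hgi n _).sub (hgi n j)).const_mul _
      _ ≤ _ := Finset.sum_le_sum fun j hj => mul_le_mul_of_nonneg_left
          (hlayer n j ((Finset.mem_range.1 hj).trans_le ht)) (by positivity)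
  set t : ℕ → ℕ := fun k => min (k + 1) (2 ^ π k) with ht_def
  have htk : ∀ k, t k ≤ k + 1 := fun k => min_le_left _ _
  have htπ : ∀ k, t k ≤ 2 ^ π k := fun k => min_le_right _ _
  have ht : Tendsto t atTop atTop := by
    refine tendsto_atTop.2 fun M => ?_
    filter_upwards [eventually_ge_atTop M, hπ.nat_tendsto_atTop.eventually_ge_atTop M] with k h1 h2
    exact le_min (by omega) (h2.trans Nat.lt_two_pow_self.le)
  have havg := h.ae_tendsto_average_min hg hg0 ha ha0 hak hπ htπ (β := β) (by
    have hsum := (((summable_sum_mul_div_succ_sq hd0 hd).mul_left 2).add (hq.mul_left 8)).add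
      (summable_const_div_succ_sq (2 * C))
    refine Summable.of_nonneg_of_le (fun k => div_nonneg (integral_nonneg fun ω => sq_nonneg _)
      (sq_nonneg _)) (fun k => ?_) hsum
    have hk : (0 : ℝ) < ((k : ℝ) + 1) ^ 2 := by positivity
    have hgsq : Integrable (fun ω => (min (g (π k) ω) (t k)) ^ 2) ν :=
      integrable_of_measurable_of_abs_le (B := (t k : ℝ) ^ 2)
        (((hg _).min measurable_const).pow_const 2) fun ω => by
          have := le_min (hg0 (π k) ω) (Nat.cast_nonneg (t k))
          rw [abs_pow, abs_of_nonneg this]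
          exact pow_le_pow_left₀ this (min_le_right _ _) 2
    have hasq : Integrable (fun ω => a (t k) ω ^ 2) ν :=
      integrable_of_measurable_of_abs_le (B := (t k : ℝ) ^ 2) ((ha _).pow_const 2) fun ω => by
          rw [abs_pow, abs_of_nonneg (ha0 _ ω)]
          exact pow_le_pow_left₀ (ha0 _ ω) (hak _ ω) 2
    have h1 : ∫ ω, (min (g (π k) ω) (t k) - a (t k) ω) ^ 2 ∂ν ≤
        2 * ∫ ω, (min (g (π k) ω) (t k)) ^ 2 ∂ν + 2 * ∫ ω, a (t k) ω ^ 2 ∂ν := by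
      rw [← integral_const_mul, ← integral_const_mul,
        ← integral_add (hgsq.const_mul 2) (hasq.const_mul 2)]
      refine integral_mono_of_nonneg (ae_of_all _ fun ω => sq_nonneg _)
        ((hgsq.const_mul 2).add (hasq.const_mul 2)) (ae_of_all _ fun ω => ?_)
      dsimp only
      nlinarith [sq_nonneg (min (g (π k) ω) (t k) + a (t k) ω)]
    have h2 : ∑ j ∈ Finset.range (t k), 2 * ((j : ℝ) + 1) * (d j + 2 * (1 / 4) ^ π k) ≤
        ∑ j ∈ Finset.range (k + 1), 2 * ((j : ℝ) + 1) * d j +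
          4 * (1 / 4) ^ π k * ((k : ℝ) + 1) ^ 2 := by
      calc _ ≤ ∑ j ∈ Finset.range (k + 1), 2 * ((j : ℝ) + 1) * (d j + 2 * (1 / 4) ^ π k) :=
            Finset.sum_le_sum_of_subset_of_nonneg (Finset.range_mono (htk k)) fun j _ _ =>
              mul_nonneg (by positivity) (add_nonneg (hd0 j) (by positivity))
        _ = ∑ j ∈ Finset.range (k + 1), 2 * ((j : ℝ) + 1) * d j +
            ∑ j ∈ Finset.range (k + 1), 4 * (1 / 4) ^ π k * ((j : ℝ) + 1) := by
            rw [← Finset.sum_add_distrib]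
            exact Finset.sum_congr rfl fun j _ => by ring
        _ ≤ _ := by
            gcongr
            have hj : ∑ j ∈ Finset.range (k + 1), 4 * (1 / 4 : ℝ) ^ π k * ((j : ℝ) + 1) ≤
                ∑ j ∈ Finset.range (k + 1), 4 * (1 / 4 : ℝ) ^ π k * ((k : ℝ) + 1) := by
              refine Finset.sum_le_sum fun j hj => ?_
              have : j ≤ k := Nat.lt_succ_iff.1 (Finset.mem_range.1 hj)
              gcongr
            refine hj.trans_eq ?_
            rw [Finset.sum_const, Finset.card_range, nsmul_eq_mul]
            push_cast; ring
    have h3 := hmoment (π k) (t k) (htπ k)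
    rw [div_le_iff₀ hk]
    have h4 : (2 * ((∑ j ∈ Finset.range (k + 1), 2 * ((j : ℝ) + 1) * d j) / ((k : ℝ) + 1) ^ 2) +
        8 * (1 / 4) ^ π k + 2 * C / ((k : ℝ) + 1) ^ 2) * ((k : ℝ) + 1) ^ 2 =
        2 * (∑ j ∈ Finset.range (k + 1), 2 * ((j : ℝ) + 1) * d j) +
        8 * (1 / 4) ^ π k * ((k : ℝ) + 1) ^ 2 + 2 * C := by
      field_simp
    rw [h4]
    linarith [hC2 (t k)])
    (hlim.mono fun ω hω => hω.comp ht)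
  have htail : ∀ k, ν.real {ω | (t k : ℝ) < g (π k) ω} ≤
      d k + 2 * (1 / 4) ^ π k + (C + 1) * (1 / 2) ^ π k := by
    intro k
    have hC0 : 0 ≤ C := (integral_nonneg (ha0 0)).trans (hC1 0)
    rcases le_total (k + 1) (2 ^ π k) with hk | hk
    · have : ν.real {ω | (t k : ℝ) < g (π k) ω} ≤
          ∫ ω, (min (g (π k) ω) (k + 1 : ℕ) - min (g (π k) ω) k) ∂ν := by
        rw [← integral_indicator_one (measurableSet_lt measurable_const (hg _))]
        refine integral_mono_of_nonneg (ae_of_all _ fun ω => Set.indicator_nonneg (by simp) ω)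
          ((hgi _ _).sub (hgi _ _)) (ae_of_all _ fun ω => ?_)
        refine Set.indicator_apply_le' (fun hω => ?_) (fun _ => ?_)
        · have h1 : ((k + 1 : ℕ) : ℝ) < g (π k) ω := by simpa [ht_def, min_eq_left hk] using hω
          have h2 : ((k : ℕ) : ℝ) ≤ g (π k) ω := by push_cast at h1; linarith
          dsimp only
          rw [min_eq_right h1.le, min_eq_right h2]
          simp
        · exact sub_nonneg.2 (min_le_min_left _ (by push_cast; linarith))
      refine (this.trans (hlayer _ _ hk)).trans (le_add_of_nonneg_right (by positivity))
    · have hpos : (0 : ℝ) < 2 ^ π k := by positivity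
      have : ν.real {ω | (t k : ℝ) < g (π k) ω} ≤
          ∫ ω, min (g (π k) ω) (2 ^ π k : ℕ) / (2 : ℝ) ^ π k ∂ν := by
        rw [← integral_indicator_one (measurableSet_lt measurable_const (hg _))]
        refine integral_mono_of_nonneg (ae_of_all _ fun ω => Set.indicator_nonneg (by simp) ω)
          ((hgi _ _).div_const _) (ae_of_all _ fun ω => ?_)
        refine Set.indicator_apply_le' (fun hω => ?_) (fun _ => ?_)
        · have h1 : ((2 ^ π k : ℕ) : ℝ) < g (π k) ω := by simpa [ht_def, min_eq_right hk] using hω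
          dsimp only
          rw [min_eq_right h1.le]
          push_cast
          rw [div_self hpos.ne', Pi.one_apply]
        · exact div_nonneg (le_min (hg0 _ ω) (Nat.cast_nonneg _)) hpos.le
      have h1 := (abs_le.1 (hdiff (π k) (2 ^ π k) le_rfl)).2
      have h2 : (1 / 4 : ℝ) ^ π k ≤ 1 := pow_le_one₀ (by norm_num) (by norm_num)
      rw [integral_div] at this
      calc _ ≤ _ := this
        _ ≤ (C + 1) / 2 ^ π k := by
            gcongr
            linarith [hC1 (2 ^ π k)]
        _ = (C + 1) * (1 / 2) ^ π k := by rw [one_div_pow]; ring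
        _ ≤ _ := le_add_of_nonneg_left (add_nonneg (hd0 k) (by positivity))
  have hbc : ∀ᵐ ω ∂ν, ∀ᶠ k in atTop, ω ∉ {ω | (t k : ℝ) < g (π k) ω} := by
    have hsum := (hd.add (hq.mul_left 2)).add
      ((summable_geometric_two.comp_injective hπ).mul_left (C + 1))
    refine ae_eventually_notMem (ne_top_of_le_ne_top hsum.tsum_ofReal_ne_top
      (ENNReal.tsum_le_tsum fun k => ?_))
    rw [← ofReal_measureReal]
    exact ENNReal.ofReal_le_ofReal (htail k)
  filter_upwards [havg, hbc] with ω h1 h2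
  refine tendsto_average_of_eventually_eq (h2.mono fun k hk => ?_) h1
  exact (min_eq_left (not_lt.1 hk)).symm

theorem ENNReal.toReal_inv_one_add_sq_mul_le_one {F : ENNReal} {x : ℝ} (hx : 0 ≤ x)
    (hF : ENNReal.ofReal x ≤ F) :
    (((1 + F)⁻¹) ^ 2).toReal * x ≤ 1 ∧ (((1 + F)⁻¹) ^ 2).toReal * x ^ 2 ≤ 1 := by
  rcases eq_or_ne F ⊤ with rfl | hT
  · simp
  have h1 : x ≤ F.toReal := (ENNReal.ofReal_le_iff_le_toReal hT).1 hF
  have h2 : (((1 + F)⁻¹) ^ 2).toReal = ((1 + F.toReal) ^ 2)⁻¹ := by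
    rw [ENNReal.toReal_pow, ENNReal.toReal_inv, ENNReal.toReal_add ENNReal.one_ne_top hT,
      ENNReal.toReal_one, inv_pow]
  have h3 : 0 < (1 + F.toReal) ^ 2 := by positivity
  rw [h2, inv_mul_le_iff₀ h3, inv_mul_le_iff₀ h3]
  constructor <;> nlinarith

theorem tendsto_ofReal_average_top {u : ℕ → ℝ} {b : ℕ → ℝ} {t : ℕ → ℕ → ℝ}
    (hb : ⨆ M, ENNReal.ofReal (b M) = ⊤)
    (h : ∀ M, Tendsto (fun N : ℕ => (∑ k ∈ Finset.range N, min (u k) (t M k)) / N) atTop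
      (𝓝 (b M))) :
    Tendsto (fun N : ℕ => ENNReal.ofReal ((∑ k ∈ Finset.range N, u k) / N)) atTop (𝓝 ⊤) := by
  refine ENNReal.tendsto_nhds_top_iff_nnreal.2 fun x => ?_
  obtain ⟨M, hM⟩ := lt_iSup_iff.1 (hb ▸ ENNReal.coe_lt_top : (x : ENNReal) < _)
  filter_upwards [((ENNReal.tendsto_ofReal (h M)).eventually_const_lt hM)] with N hN
  refine hN.trans_le (ENNReal.ofReal_le_ofReal ?_)
  gcongr
  exact min_le_left _ _

end

/-- Von Weizsäcker's theorem (permutation version): every sequence of non-negative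
random variables has a subsequence `g` such that the Cesàro means of every
permutation of `g` converge a.e. to a fixed `[0, ∞]`-valued measurable function. -/
theorem vonWeizsacker_permutation
    {Ω : Type*} [MeasurableSpace Ω] (μ : Measure Ω) [IsProbabilityMeasure μ]
    (f : ℕ → Ω → ℝ) (hmeas : ∀ n, Measurable (f n)) (hnonneg : ∀ n ω, 0 ≤ f n ω) :
    ∃ (F : Ω → ENNReal), Measurable F ∧ ∃ φ : ℕ → ℕ, StrictMono φ ∧
      ∀ π : ℕ → ℕ, Function.Bijective π →
        ∀ᵐ ω ∂μ, Tendsto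
          (fun n : ℕ => ENNReal.ofReal ((∑ k ∈ Finset.range n, f (φ (π k)) ω) / n))
          atTop (𝓝 (F ω)) := by
  have hfm : ∀ n k : ℕ, Measurable fun ω => min (f n ω) (k : ℝ) := fun n k =>
    (hmeas n).min measurable_const
  have hf0 : ∀ (n k : ℕ) ω, 0 ≤ min (f n ω) (k : ℝ) := fun n k ω =>
    le_min (hnonneg n ω) (Nat.cast_nonneg k)
  choose a ha ha0 hak hlim using fun k : ℕ =>
    exists_weak_limit_of_bounded μ (hyperfilter ℕ) (f := fun n ω => min (f n ω) k)
      (fun n => hfm n k) (fun n => hf0 n k) (fun n ω => min_le_right _ _)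
  have hai : ∀ k, Integrable (a k) μ := fun k =>
    integrable_of_measurable_of_abs_le (ha k) fun ω => by
      rw [abs_of_nonneg (ha0 k ω)]; exact hak k ω
  have hfi : ∀ n k : ℕ, Integrable (fun ω => min (f n ω) (k : ℝ)) μ := fun n k =>
    integrable_of_measurable_of_abs_le (B := k) (hfm n k) fun ω => by
      rw [abs_of_nonneg (hf0 n k ω)]; exact min_le_right _ _
  have hmono : ∀ᵐ ω ∂μ, Monotone fun k => a k ω := by
    refine (ae_all_iff.2 fun k => ?_).mono fun ω hω => monotone_nat_of_le_succ hω
    exact ae_le_of_tendsto_integral_mul (fun n => hfi n k) (fun n => hfi n (k + 1)) (hai k)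
      (hai (k + 1)) (fun n ω => min_le_min_left _ (by push_cast; linarith)) (hlim k) (hlim (k + 1))
  set F : Ω → ENNReal := fun ω => ⨆ k, ENNReal.ofReal (a k ω) with hF
  have hFm : Measurable F := Measurable.iSup fun k => (ha k).ennreal_ofReal
  have haF : ∀ k ω, ENNReal.ofReal (a k ω) ≤ F ω := fun k ω =>
    le_iSup (fun k => ENNReal.ofReal (a k ω)) k
  set w : Ω → ENNReal := fun ω => ((1 + F ω)⁻¹) ^ 2 with hw
  have hwm : Measurable w := (measurable_const.add hFm).inv.pow_const 2
  have hw1 : ∀ ω, w ω ≤ 1 := fun ω =>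
    pow_le_one₀ zero_le (ENNReal.inv_le_one.2 le_self_add)
  have hwT : ∀ᵐ ω ∂μ, w ω < ⊤ := ae_of_all _ fun ω => (hw1 ω).trans_lt ENNReal.one_lt_top
  have hw1' : ∀ ω, (w ω).toReal ≤ 1 := fun ω => ENNReal.toReal_le_of_le_ofReal one_pos.le
    (by simpa using hw1 ω)
  set ν : Measure Ω := μ.withDensity w with hν
  have hνint : ∀ h : Ω → ℝ, ∫ ω, h ω ∂ν = ∫ ω, (w ω).toReal * h ω ∂μ :=
    integral_withDensity_eq_integral_toReal_smul hwm hwT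
  have : IsFiniteMeasure ν := isFiniteMeasure_withDensity (ne_top_of_le_ne_top ENNReal.one_ne_top
    ((lintegral_mono hw1).trans (by simp)))
  have hlimν : ∀ (k : ℕ) (v : Ω → ℝ), Measurable v → (∃ B, ∀ ω, |v ω| ≤ B) →
      Tendsto (fun n => ∫ ω, min (f n ω) k * v ω ∂ν) (hyperfilter ℕ)
        (𝓝 (∫ ω, a k ω * v ω ∂ν)) := by
    rintro k v hv ⟨B, hB⟩
    simp only [hνint, mul_left_comm (w _).toReal]
    refine hlim k _ (hwm.ennreal_toReal.mul hv) ⟨B, fun ω => ?_⟩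
    rw [abs_mul, abs_of_nonneg ENNReal.toReal_nonneg]
    exact (mul_le_of_le_one_left (abs_nonneg _) (hw1' ω)).trans (hB ω)
  obtain ⟨φ, hφ, hsel⟩ := exists_strictMono_of_forall_exists_gt fun n p =>
    (((eventually_gt_atTop p).filter_mono Nat.hyperfilter_le_atTop).and
      ((eventually_almost_uncorrelated hmeas hnonneg ha ha0 hak hlim (2 ^ n) p
        (show (0 : ℝ) < (1 / 4) ^ n by positivity)).and
      (eventually_almost_uncorrelated hmeas hnonneg ha ha0 hak hlimν (2 ^ n) p
        (show (0 : ℝ) < (1 / 4) ^ n by positivity)))).exists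
  have hμ_unc : AlmostUncorrelated μ (fun n => f (φ n)) a := by
    refine ⟨fun n => ?_, fun n m hm k l hk hl => ?_⟩ <;> obtain ⟨p, hp, h1, -⟩ := hsel n
    · exact h1.1
    · exact h1.2 _ (hp m hm) k hk l hl
  have hν_unc : AlmostUncorrelated ν (fun n => f (φ n)) a := by
    refine ⟨fun n => ?_, fun n m hm k l hk hl => ?_⟩ <;> obtain ⟨p, hp, -, h1⟩ := hsel n
    · exact h1.1
    · exact h1.2 _ (hp m hm) k hk l hl
  refine ⟨F, hFm, φ, hφ, fun π hπ => ?_⟩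
  have hmonoν : ∀ᵐ ω ∂ν, Monotone fun k => a k ω :=
    (withDensity_absolutelyContinuous μ w).ae_le hmono
  have hfinν : ∀ᵐ ω ∂ν, F ω ≠ ⊤ := by
    rw [ae_withDensity_iff hwm]
    refine ae_of_all _ fun ω h0 hT => h0 ?_
    simp [hw, hT]
  have hνavg := hν_unc.ae_tendsto_average (fun n => hmeas _) (fun n => hnonneg _) ha ha0 hak hmonoν
    (C := 1) (fun k => ?_) (fun k => ?_) (β := fun ω => (F ω).toReal) ?_ hπ.injective
  · have hμavg := ae_all_iff.2 fun M => hμ_unc.ae_tendsto_average_min_const (fun n => hmeas _)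
      (fun n => hnonneg _) ha ha0 hak hπ.injective M
    rw [ae_withDensity_iff hwm] at hνavg
    filter_upwards [hνavg, hμavg] with ω h1 h2
    by_cases hT : F ω = ⊤
    · rw [hT]
      exact tendsto_ofReal_average_top hT h2
    · have hw0 : w ω ≠ 0 := by simp [hw, hT]
      simpa only [ENNReal.ofReal_toReal hT] using ENNReal.tendsto_ofReal (h1 hw0)
  · rw [hνint]
    calc _ ≤ ∫ _, (1 : ℝ) ∂μ := integral_mono_of_nonneg
          (ae_of_all _ fun ω => mul_nonneg ENNReal.toReal_nonneg (ha0 k ω)) (integrable_const _)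
          (ae_of_all _ fun ω => (ENNReal.toReal_inv_one_add_sq_mul_le_one (ha0 k ω) (haF k ω)).1)
      _ = 1 := by simp
  · rw [hνint]
    calc _ ≤ ∫ _, (1 : ℝ) ∂μ := integral_mono_of_nonneg
          (ae_of_all _ fun ω => mul_nonneg ENNReal.toReal_nonneg (sq_nonneg _)) (integrable_const _)
          (ae_of_all _ fun ω => (ENNReal.toReal_inv_one_add_sq_mul_le_one (ha0 k ω) (haF k ω)).2)
      _ = 1 := by simp
  · filter_upwards [hmonoν, hfinν] with ω h1 h2
    have h3 : Tendsto (fun k => ENNReal.ofReal (a k ω)) atTop (𝓝 (F ω)) :=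
      tendsto_atTop_iSup fun i j hij => ENNReal.ofReal_le_ofReal (h1 hij)
    simpa [ENNReal.toReal_ofReal (ha0 _ ω), Function.comp_def] using
      (ENNReal.tendsto_toReal h2).comp h3
end

section
/- Berkes' theorem: Let (Ω, Σ, μ) be a probability space and (f_n)_{n≥1} a sequence of real-valued integrable functions with sup_n ∫ |f_n| dμ < ∞. Then there exist f ∈ L¹(μ) and a strictly increasing map φ : ℕ → ℕ such that, setting g_n = f_{φ(n)}, for every bijection π : ℕ → ℕ the Cesàro means (1/n) ∑_{k=1}^n g_{π(k)}(ω) converge to f(ω) for μ-almost every ω ∈ Ω. -/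
open MeasureTheory Filter Topology

/-- **Kronecker's lemma** for absolutely summable weights `1 / (k + 1)`. -/
lemma tendsto_sum_div_of_summable_div {a : ℕ → ℝ} (h : Summable fun k : ℕ => |a k| / (k + 1)) :
    Tendsto (fun n : ℕ => (∑ k ∈ Finset.range n, a k) / n) atTop (𝓝 0) := by
  have key : Tendsto (fun n : ℕ => ∑' k, if k < n then a k / n else 0) atTop
      (𝓝 (∑' _ : ℕ, (0 : ℝ))) := by
    refine tendsto_tsum_of_dominated_convergence h (fun k => ?_) (Eventually.of_forall fun n k => ?_)
    · have h0 : Tendsto (fun n : ℕ => a k / n) atTop (𝓝 0) :=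
        tendsto_const_nhds.div_atTop tendsto_natCast_atTop_atTop
      refine h0.congr' ?_
      filter_upwards [eventually_gt_atTop k] with n hn
      simp [hn]
    · split_ifs with hk
      · have : (k : ℝ) + 1 ≤ n := by exact_mod_cast hk
        rw [Real.norm_eq_abs, abs_div, Nat.abs_cast]
        gcongr
      · simp only [norm_zero]; positivity
  rw [tsum_zero] at key
  refine key.congr fun n => ?_
  rw [tsum_eq_sum (s := Finset.range n) (by intro k hk; simp at hk; simp [hk]), Finset.sum_div]
  refine Finset.sum_congr rfl fun k hk => ?_
  simp [Finset.mem_range.1 hk]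

/-- Nonnegative functions whose integrals are summable are almost everywhere summable. -/
lemma ae_summable_of_summable_integral {Ω : Type*} [MeasurableSpace Ω] {μ : Measure Ω}
    {g : ℕ → Ω → ℝ} (hg : ∀ k, Integrable (g k) μ) (h0 : ∀ k, 0 ≤ᵐ[μ] g k)
    (hs : Summable fun k => ∫ ω, g k ω ∂μ) : ∀ᵐ ω ∂μ, Summable fun k => g k ω := by
  have h : ∑' k, eLpNorm (g k) 1 μ ≠ ⊤ := by
    have e (k : ℕ) : eLpNorm (g k) 1 μ = ENNReal.ofReal (∫ ω, g k ω ∂μ) := by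
      rw [eLpNorm_one_eq_lintegral_enorm, ← ofReal_integral_norm_eq_lintegral_enorm (hg k)]
      congr 1
      refine integral_congr_ae ?_
      filter_upwards [h0 k] with ω hω using Real.norm_of_nonneg hω
    simp_rw [e]
    exact hs.tsum_ofReal_ne_top
  filter_upwards [summable_norm_of_tsum_eLpNorm_ne_top le_rfl (fun k => (hg k).1) h] with ω hω
  exact hω.of_norm

/-- A sequence of functions with uniformly bounded second moments has a weak limit in `L²` along
any ultrafilter. -/
lemma exists_weak_limit_of_integral_sq_le {Ω : Type*} [MeasurableSpace Ω] {μ : Measure Ω}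
    (𝒰 : Ultrafilter ℕ) {u : ℕ → Ω → ℝ} (hu : ∀ n, MemLp (u n) 2 μ) {B : ℝ}
    (hB : ∀ n, ∫ ω, u n ω ^ 2 ∂μ ≤ B) :
    ∃ w : Ω → ℝ, MemLp w 2 μ ∧ ∀ g : Ω → ℝ, MemLp g 2 μ →
      Tendsto (fun n => ∫ ω, u n ω * g ω ∂μ) 𝒰 (𝓝 (∫ ω, w ω * g ω ∂μ)) := by
  have inner_toLp {a b : Ω → ℝ} (ha : MemLp a 2 μ) (hb : MemLp b 2 μ) :
      inner ℝ (ha.toLp a) (hb.toLp b) = ∫ ω, a ω * b ω ∂μ := by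
    rw [L2.inner_def]
    refine integral_congr_ae ?_
    filter_upwards [ha.coeFn_toLp, hb.coeFn_toLp] with ω h1 h2
    simp [h1, h2, mul_comm]
  let D (n : ℕ) : WeakDual ℝ (Lp ℝ 2 μ) :=
    StrongDual.toWeakDual (InnerProductSpace.toDual ℝ (Lp ℝ 2 μ) ((hu n).toLp (u n)))
  have hD (n : ℕ) : D n ∈ WeakDual.toStrongDual ⁻¹' Metric.closedBall
      (0 : StrongDual ℝ (Lp ℝ 2 μ)) (√B) := by
    have : ‖(hu n).toLp (u n)‖ ≤ √B := by
      refine Real.le_sqrt_of_sq_le ?_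
      rw [← real_inner_self_eq_norm_sq, inner_toLp (hu n) (hu n)]
      simpa [sq] using hB n
    simpa [D] using this
  obtain ⟨x, -, hx⟩ :=
    (WeakDual.isCompact_closedBall (0 : StrongDual ℝ (Lp ℝ 2 μ)) (√B)).ultrafilter_le_nhds
    (𝒰.map D) (by
      rw [Ultrafilter.coe_map]
      exact le_principal_iff.2 (Filter.mem_map.2 (Eventually.of_forall hD)))
  let w : Lp ℝ 2 μ := (InnerProductSpace.toDual ℝ (Lp ℝ 2 μ)).symm (WeakDual.toStrongDual x)
  refine ⟨w, Lp.memLp w, fun g hg => ?_⟩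
  have h1 : Tendsto D 𝒰 (𝓝 x) := hx
  have h2 := ((WeakDual.eval_continuous (hg.toLp g)).tendsto x).comp h1
  have e : x (hg.toLp g) = ∫ ω, w ω * g ω ∂μ := by
    rw [← inner_toLp (Lp.memLp w) hg, Lp.toLp_coeFn]
    simp [w]
  rw [← e]
  refine h2.congr fun n => ?_
  rw [← inner_toLp (hu n) hg]
  simp [D]

/-- The partial sums of `∑ min(x, k + 1)² / (k + 1)²` are at most `3 x`. -/
lemma sum_min_sq_div_le {x : ℝ} (hx : 0 ≤ x) (K : ℕ) :
    ∑ k ∈ Finset.range K, min x ((k : ℝ) + 1) ^ 2 / ((k : ℝ) + 1) ^ 2 ≤ 3 * x := by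
  set a := ⌊x⌋₊
  have hax : (a : ℝ) ≤ x := Nat.floor_le hx
  have hxa : x < a + 1 := Nat.lt_floor_add_one x
  have h1 : ∀ k ∈ Finset.range K, min x ((k : ℝ) + 1) ^ 2 / ((k : ℝ) + 1) ^ 2 ≤
      (if k < a then 1 else 0) +
        x ^ 2 * (if k + 1 ∈ Finset.Ioo a (K + 1) then (((k + 1 : ℕ) : ℝ) ^ 2)⁻¹ else 0) := by
    intro k hk
    rw [Finset.mem_range] at hk
    have hm : 0 ≤ min x ((k : ℝ) + 1) := by positivity
    by_cases hka : k < a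
    · have h2 : ¬ (k + 1 ∈ Finset.Ioo a (K + 1)) := by simp; omega
      rw [if_pos hka, if_neg h2, mul_zero, add_zero, div_le_one (by positivity)]
      exact pow_le_pow_left₀ hm (min_le_right _ _) 2
    · have h2 : k + 1 ∈ Finset.Ioo a (K + 1) := by simp; omega
      rw [if_neg hka, if_pos h2, zero_add, ← div_eq_mul_inv]
      push_cast
      gcongr
      exact min_le_left _ _
  refine (Finset.sum_le_sum h1).trans ?_
  rw [Finset.sum_add_distrib, ← Finset.mul_sum]
  have h3 : ∑ k ∈ Finset.range K, (if k < a then (1 : ℝ) else 0) ≤ x := by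
    rw [← Finset.sum_filter]
    simp only [Finset.sum_const, nsmul_eq_mul, mul_one]
    refine le_trans ?_ hax
    have : (Finset.range K).filter (· < a) ⊆ Finset.range a := by
      intro k; simp
    exact_mod_cast (Finset.card_le_card this).trans (Finset.card_range a).le
  have h4 : ∑ k ∈ Finset.range K,
      (if k + 1 ∈ Finset.Ioo a (K + 1) then (((k + 1 : ℕ) : ℝ) ^ 2)⁻¹ else 0) ≤ 2 / (a + 1) := by
    refine le_trans ?_ (sum_Ioo_inv_sq_le a (K + 1))
    rw [← Finset.sum_filter, ← Finset.sum_image (g := fun k => k + 1)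
      (f := fun i : ℕ => ((i : ℝ) ^ 2)⁻¹) (by intro i _ j _ h; simpa using h)]
    refine Finset.sum_le_sum_of_subset_of_nonneg ?_ (by intros; positivity)
    intro i hi
    obtain ⟨k, hk, rfl⟩ := Finset.mem_image.1 hi
    exact (Finset.mem_filter.1 hk).2
  have h5 : x ^ 2 * (2 / (a + 1)) ≤ 2 * x := by
    rw [mul_div_assoc', div_le_iff₀ (by positivity)]
    nlinarith
  nlinarith [mul_le_mul_of_nonneg_left h4 (sq_nonneg x)]

/-- If the second moments of the partial sums of `X` are controlled by the partial sums of `b`,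
where `∑ b k / (k + 1)²` converges, then the Cesàro means of `X` tend to zero almost everywhere
along geometrically growing indices. -/
lemma ae_tendsto_sum_div_floor_pow {Ω : Type*} [MeasurableSpace Ω] {μ : Measure Ω}
    {X : ℕ → Ω → ℝ} (hX : ∀ k, MemLp (X k) 2 μ) {b : ℕ → ℝ} (hb0 : ∀ k, 0 ≤ b k)
    (hb : Summable fun k : ℕ => b k / ((k : ℝ) + 1) ^ 2)
    (h : ∀ N, ∫ ω, (∑ k ∈ Finset.range N, X k ω) ^ 2 ∂μ ≤ ∑ k ∈ Finset.range N, b k)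
    {c : ℝ} (hc : 1 < c) :
    ∀ᵐ ω ∂μ, Tendsto (fun p : ℕ => (∑ k ∈ Finset.range ⌊c ^ p⌋₊, X k ω) / ⌊c ^ p⌋₊)
      atTop (𝓝 0) := by
  have hS (N : ℕ) : MemLp (fun ω => ∑ k ∈ Finset.range N, X k ω) 2 μ :=
    memLp_finsetSum _ fun k _ => hX k
  have hsum : ∀ᵐ ω ∂μ, Summable fun p : ℕ =>
      ((∑ k ∈ Finset.range ⌊c ^ p⌋₊, X k ω) / ⌊c ^ p⌋₊) ^ 2 := by
    refine ae_summable_of_summable_integral (fun p => ?_)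
      (fun p => Eventually.of_forall fun ω => sq_nonneg _) ?_
    · simp_rw [div_pow]
      exact (hS _).integrable_sq.div_const _
    set A : ℝ := 4 * (c ^ 5 * (c - 1)⁻¹ ^ 3) with hA
    have hA0 : 0 ≤ A := by have := sub_pos.2 hc; positivity
    refine summable_of_sum_range_le (c := ∑' k : ℕ, b k / ((k : ℝ) + 1) ^ 2 * A)
      (fun p => integral_nonneg fun ω => sq_nonneg _) fun P => ?_
    have hle : ∀ p ∈ Finset.range P,
        ∫ ω, ((∑ k ∈ Finset.range ⌊c ^ p⌋₊, X k ω) / ⌊c ^ p⌋₊) ^ 2 ∂μ ≤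
        ∑ k ∈ Finset.range ⌊c ^ P⌋₊,
          b k * if ((k : ℝ) + 1) / 2 < ⌊c ^ p⌋₊ then 1 / (⌊c ^ p⌋₊ : ℝ) ^ 2 else 0 := by
      intro p hp
      have hsub : Finset.range ⌊c ^ p⌋₊ ⊆ Finset.range ⌊c ^ P⌋₊ :=
        Finset.range_mono (Nat.floor_mono
          (pow_le_pow_right₀ hc.le (Finset.mem_range.1 hp).le))
      simp_rw [div_pow]
      rw [integral_div]
      calc _ ≤ (∑ k ∈ Finset.range ⌊c ^ p⌋₊, b k) / (⌊c ^ p⌋₊ : ℝ) ^ 2 := by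
            gcongr; exact h _
        _ = ∑ k ∈ Finset.range ⌊c ^ p⌋₊,
            b k * if ((k : ℝ) + 1) / 2 < ⌊c ^ p⌋₊ then 1 / (⌊c ^ p⌋₊ : ℝ) ^ 2 else 0 := by
            rw [Finset.sum_div]
            refine Finset.sum_congr rfl fun k hk => ?_
            have hk' : (k : ℝ) + 1 ≤ ⌊c ^ p⌋₊ := by exact_mod_cast Finset.mem_range.1 hk
            have hk0 : (0 : ℝ) ≤ k := k.cast_nonneg
            rw [if_pos (by linarith), mul_one_div]
        _ ≤ _ := by
            refine Finset.sum_le_sum_of_subset_of_nonneg hsub fun k _ _ => mul_nonneg (hb0 k) ?_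
            split_ifs <;> positivity
    refine (Finset.sum_le_sum hle).trans ?_
    rw [Finset.sum_comm]
    refine le_trans (Finset.sum_le_sum fun k _ => ?_)
      ((hb.mul_right A).sum_le_tsum (Finset.range ⌊c ^ P⌋₊)
        fun k _ => mul_nonneg (div_nonneg (hb0 k) (by positivity)) hA0)
    rw [← Finset.mul_sum, ← Finset.sum_filter, div_mul_eq_mul_div, mul_div_assoc]
    refine mul_le_mul_of_nonneg_left ?_ (hb0 k)
    refine (sum_div_nat_floor_pow_sq_le_div_sq P (j := ((k : ℝ) + 1) / 2) (by positivity) hc).trans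
      (le_of_eq ?_)
    rw [hA]
    field_simp
    norm_num
  filter_upwards [hsum] with ω hω
  rw [tendsto_zero_iff_abs_tendsto_zero]
  have := (Real.continuous_sqrt.tendsto 0).comp hω.tendsto_atTop_zero
  simpa [Function.comp_def, Real.sqrt_sq_eq_abs] using this

/-- An almost everywhere monotone sequence of nonnegative functions with bounded integrals
converges almost everywhere to an integrable function. -/
lemma exists_integrable_ae_tendsto_of_monotone {Ω : Type*} [MeasurableSpace Ω] {μ : Measure Ω}
    {w : ℕ → Ω → ℝ} (hw : ∀ k, Integrable (w k) μ) (h0 : ∀ k, 0 ≤ᵐ[μ] w k)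
    (hm : ∀ k, w k ≤ᵐ[μ] w (k + 1)) {C : ℝ} (hC : ∀ k, ∫ ω, w k ω ∂μ ≤ C) :
    ∃ F : Ω → ℝ, Integrable F μ ∧ ∀ᵐ ω ∂μ, Tendsto (fun k => w k ω) atTop (𝓝 (F ω)) := by
  have hs : ∀ᵐ ω ∂μ, Summable fun k => w (k + 1) ω - w k ω := by
    refine ae_summable_of_summable_integral (fun k => (hw (k + 1)).sub (hw k)) (fun k => ?_) ?_
    · filter_upwards [hm k] with ω hω using sub_nonneg.2 hω
    · refine summable_of_sum_range_le (c := C) (fun k => ?_) fun n => ?_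
      · refine integral_nonneg_of_ae ?_
        filter_upwards [hm k] with ω hω using sub_nonneg.2 hω
      · simp_rw [fun k => integral_sub (hw (k + 1)) (hw k)]
        rw [Finset.sum_range_sub (fun k => ∫ ω, w k ω ∂μ)]
        linarith [hC n, integral_nonneg_of_ae (h0 0)]
  let F : Ω → ℝ := fun ω => w 0 ω + ∑' k, (w (k + 1) ω - w k ω)
  have hF : ∀ᵐ ω ∂μ, Tendsto (fun k => w k ω) atTop (𝓝 (F ω)) := by
    filter_upwards [hs] with ω hω
    refine (hω.hasSum.tendsto_sum_nat.const_add (w 0 ω)).congr fun n => ?_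
    rw [Finset.sum_range_sub (fun k => w k ω)]
    ring
  refine ⟨F, memLp_one_iff_integrable.1
    ⟨aestronglyMeasurable_of_tendsto_ae _ (fun k => (hw k).1) hF, ?_⟩, hF⟩
  refine (Lp.eLpNorm_lim_le_liminf_eLpNorm (fun k => (hw k).1) F hF).trans_lt ?_
  refine lt_of_le_of_lt (liminf_le_of_le (a := ENNReal.ofReal C) ?_ ?_) ENNReal.ofReal_lt_top
  · isBoundedDefault
  · intro b hb
    obtain ⟨k, hk⟩ := hb.exists
    refine hk.trans ?_
    rw [eLpNorm_one_eq_lintegral_enorm, ← ofReal_integral_norm_eq_lintegral_enorm (hw k)]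
    refine ENNReal.ofReal_le_ofReal (le_trans (le_of_eq ?_) (hC k))
    refine integral_congr_ae ?_
    filter_upwards [h0 k] with ω hω using Real.norm_of_nonneg hω

/-- Truncations of an integrable nonnegative function are square integrable. -/
lemma memLp_two_min_const {Ω : Type*} [MeasurableSpace Ω] {μ : Measure Ω} [IsFiniteMeasure μ]
    {f : Ω → ℝ} (hf : Integrable f μ) (h0 : ∀ ω, 0 ≤ f ω) {c : ℝ} (hc : 0 ≤ c) :
    MemLp (fun ω => min (f ω) c) 2 μ := by
  refine MemLp.of_bound (hf.1.inf aestronglyMeasurable_const) c (Eventually.of_forall fun ω => ?_)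
  rw [Real.norm_of_nonneg (le_min (h0 ω) hc)]
  exact min_le_right _ _

/-- An `L¹`-bounded sequence of nonnegative functions has a subsequence whose truncations are
almost orthogonal, up to subtracting weak limits `w`, with controlled second moments. -/
lemma exists_subseq_almost_orthogonal
    {Ω : Type*} [MeasurableSpace Ω] (μ : Measure Ω) [IsProbabilityMeasure μ]
    (f : ℕ → Ω → ℝ) (hint : ∀ n, Integrable (f n) μ) (h0 : ∀ n ω, 0 ≤ f n ω)
    {C : ℝ} (hC : ∀ n, ∫ ω, f n ω ∂μ ≤ C) :
    ∃ (w : ℕ → Ω → ℝ) (q : ℕ → ℝ) (φ : ℕ → ℕ), StrictMono φ ∧ (∀ k, MemLp (w k) 2 μ) ∧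
      (∀ k, 0 ≤ᵐ[μ] w k) ∧ (∀ k, w k ≤ᵐ[μ] w (k + 1)) ∧ (∀ k, ∫ ω, w k ω ∂μ ≤ C) ∧
      (Summable fun k : ℕ => q k / ((k : ℝ) + 1) ^ 2) ∧ (∀ k, ∫ ω, w k ω ^ 2 ∂μ ≤ q k) ∧
      (∀ m, ∀ k : ℕ, k ≤ 2 ^ m → ∫ ω, min (f (φ m) ω) ((k : ℝ) + 1) ^ 2 ∂μ ≤ q k + 1) ∧
      (∀ m, ∀ n < m, ∀ i : ℕ, i ≤ 2 ^ m → ∀ j : ℕ, j ≤ 2 ^ m →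
        |∫ ω, (min (f (φ m) ω) ((j : ℝ) + 1) - w j ω) *
          (min (f (φ n) ω) ((i : ℝ) + 1) - w i ω) ∂μ| ≤ (1 / 2) ^ n * (1 / 2) ^ m) := by
  set 𝒰 : Ultrafilter ℕ := hyperfilter ℕ
  set t : ℕ → ℕ → Ω → ℝ := fun k n ω => min (f n ω) ((k : ℝ) + 1)
  have htL (k n : ℕ) : MemLp (t k n) 2 μ := memLp_two_min_const (hint n) (h0 n) (by positivity)
  have ht0 (k n : ℕ) (ω : Ω) : 0 ≤ t k n ω := le_min (h0 n ω) (by positivity)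
  have htk (k n : ℕ) (ω : Ω) : t k n ω ≤ (k : ℝ) + 1 := min_le_right _ _
  have hti (k n : ℕ) : Integrable (t k n) μ := (htL k n).integrable one_le_two
  have htB (k n : ℕ) : ∫ ω, t k n ω ^ 2 ∂μ ≤ ((k : ℝ) + 1) ^ 2 := by
    refine (integral_mono (htL k n).integrable_sq (integrable_const (((k : ℝ) + 1) ^ 2))
      fun ω => pow_le_pow_left₀ (ht0 k n ω) (htk k n ω) 2).trans (by simp)
  choose w hwL hw using fun k => exists_weak_limit_of_integral_sq_le 𝒰 (htL k) (htB k)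
  have hwi (k : ℕ) : Integrable (w k) μ := (hwL k).integrable one_le_two
  have hq (k : ℕ) : ∃ q, Tendsto (fun n => ∫ ω, t k n ω ^ 2 ∂μ) 𝒰 (𝓝 q) := by
    obtain ⟨q, -, hq⟩ := (isCompact_Icc (a := (0 : ℝ)) (b := ((k : ℝ) + 1) ^ 2)).ultrafilter_le_nhds
      (𝒰.map fun n => ∫ ω, t k n ω ^ 2 ∂μ) (by
        rw [Ultrafilter.coe_map]
        exact le_principal_iff.2 (Filter.mem_map.2 (Eventually.of_forall fun n =>
          ⟨integral_nonneg fun ω => sq_nonneg _, htB k n⟩)))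
    exact ⟨q, hq⟩
  choose q hq using hq
  have hset (k : ℕ) {s : Set Ω} (hs : MeasurableSet s) :
      Tendsto (fun n => ∫ ω in s, t k n ω ∂μ) 𝒰 (𝓝 (∫ ω in s, w k ω ∂μ)) := by
    have e (g : Ω → ℝ) : ∫ ω, g ω * s.indicator (fun _ => (1 : ℝ)) ω ∂μ = ∫ ω in s, g ω ∂μ := by
      rw [← integral_indicator hs]
      congr 1 with ω
      by_cases h : ω ∈ s <;> simp [h]
    have := hw k (s.indicator fun _ => (1 : ℝ)) ((memLp_const 1).indicator hs)
    simpa only [e] using this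
  have hw0 (k : ℕ) : 0 ≤ᵐ[μ] w k := by
    refine ae_le_of_forall_setIntegral_le (integrable_zero _ _ _) (hwi k) fun s hs _ => ?_
    refine ge_of_tendsto (hset k hs) (Eventually.of_forall fun n => ?_)
    simpa using integral_nonneg (μ := μ.restrict s) (ht0 k n)
  have hwm (k : ℕ) : w k ≤ᵐ[μ] w (k + 1) := by
    refine ae_le_of_forall_setIntegral_le (hwi k) (hwi (k + 1)) fun s hs _ => ?_
    refine le_of_tendsto_of_tendsto' (hset k hs) (hset (k + 1) hs) fun n => ?_
    refine integral_mono (hti k n).integrableOn (hti (k + 1) n).integrableOn fun ω => ?_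
    refine min_le_min_left _ ?_
    push_cast
    linarith
  have hwC (k : ℕ) : ∫ ω, w k ω ∂μ ≤ C := by
    have := hset k MeasurableSet.univ
    simp only [Measure.restrict_univ] at this
    exact le_of_tendsto this (Eventually.of_forall fun n =>
      (integral_mono (hti k n) (hint n) fun ω => min_le_left _ _).trans (hC n))
  have hqw (k : ℕ) : ∫ ω, w k ω ^ 2 ∂μ ≤ q k := by
    have h1 := hw k (w k) (hwL k)
    have h2 : ∫ ω, w k ω * w k ω ∂μ ≤ (q k + ∫ ω, w k ω ^ 2 ∂μ) / 2 := by
      refine le_of_tendsto_of_tendsto' h1 (((hq k).add_const _).div_const 2) fun n => ?_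
      rw [← integral_add (htL k n).integrable_sq (hwL k).integrable_sq, ← integral_div]
      refine integral_mono ((htL k n).integrable_mul (hwL k))
        (((htL k n).integrable_sq.add (hwL k).integrable_sq).div_const 2) fun ω => ?_
      simp only
      linarith [two_mul_le_add_sq (t k n ω) (w k ω)]
    simp_rw [← sq] at h2
    linarith
  have hq0 (k : ℕ) : 0 ≤ q k := (integral_nonneg fun ω => sq_nonneg _).trans (hqw k)
  have hqs : Summable fun k : ℕ => q k / ((k : ℝ) + 1) ^ 2 := by
    refine summable_of_sum_range_le (c := 3 * C) (fun k => div_nonneg (hq0 k) (by positivity))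
      fun K => ?_
    refine le_of_tendsto (tendsto_finsetSum (Finset.range K) fun k _ =>
      (hq k).div_const (((k : ℝ) + 1) ^ 2)) (Eventually.of_forall fun n => ?_)
    simp_rw [← integral_div]
    rw [← integral_finsetSum _ fun k _ => (htL k n).integrable_sq.div_const _]
    refine (integral_mono (integrable_finsetSum _ fun k _ =>
      (htL k n).integrable_sq.div_const _) ((hint n).const_mul 3)
      fun ω => sum_min_sq_div_le (h0 n ω) K).trans ?_
    rw [integral_const_mul]
    linarith [hC n]
  have hortho (a i j : ℕ) {ε : ℝ} (hε : 0 < ε) :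
      ∀ᶠ b in (𝒰 : Filter ℕ), |∫ ω, (t j b ω - w j ω) * (t i a ω - w i ω) ∂μ| ≤ ε := by
    have hg : MemLp (fun ω => t i a ω - w i ω) 2 μ := (htL i a).sub (hwL i)
    have h1 := (hw j _ hg).sub_const (∫ ω, w j ω * (t i a ω - w i ω) ∂μ)
    rw [sub_self] at h1
    filter_upwards [h1.abs.eventually_le_const (by simpa using hε)] with b hb
    have e : ∫ ω, (t j b ω - w j ω) * (t i a ω - w i ω) ∂μ =
        ∫ ω, t j b ω * (t i a ω - w i ω) ∂μ - ∫ ω, w j ω * (t i a ω - w i ω) ∂μ := by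
      simp only [sub_mul _ _ (_ - _)]
      exact integral_sub ((htL j b).integrable_mul hg) ((hwL j).integrable_mul hg)
    rwa [e]
  have hall {P : ℕ → ℕ → Prop} (h : ∀ k, ∀ᶠ b in (𝒰 : Filter ℕ), P k b) (N : ℕ) :
      ∀ᶠ b in (𝒰 : Filter ℕ), ∀ k ≤ N, P k b :=
    (eventually_all_finite (Set.finite_Iic N)).2 fun k _ => h k
  have hstep (m a : ℕ) : ∃ b, a < b ∧ (∀ k ≤ 2 ^ m, ∫ ω, t k b ω ^ 2 ∂μ ≤ q k + 1) ∧
      ∀ a' ≤ a, ∀ i ≤ 2 ^ m, ∀ j ≤ 2 ^ m,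
        |∫ ω, (t j b ω - w j ω) * (t i a' ω - w i ω) ∂μ| ≤ (1 / 2) ^ m * (1 / 2) ^ m := by
    refine Eventually.exists (f := (𝒰 : Filter ℕ)) ?_
    filter_upwards [Nat.hyperfilter_le_atTop (eventually_gt_atTop a),
      hall (fun k => (hq k).eventually_le_const (lt_add_one (q k))) (2 ^ m),
      hall (fun a' => hall (fun i => hall (fun j => hortho a' i j
        (by positivity : (0 : ℝ) < (1 / 2) ^ m * (1 / 2) ^ m)) (2 ^ m)) (2 ^ m)) a]
      with b h1 h2 h3 using ⟨h1, h2, h3⟩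
  choose s hs1 hs2 hs3 using hstep
  let φ : ℕ → ℕ := Nat.rec (s 0 0) fun m a => s (m + 1) a
  have hφ (m : ℕ) : φ (m + 1) = s (m + 1) (φ m) := rfl
  have hmono : StrictMono φ := strictMono_nat_of_lt_succ fun m => by
    rw [hφ]; exact hs1 _ _
  refine ⟨w, q, φ, hmono, hwL, hw0, hwm, hwC, hqs, hqw, fun m => ?_, fun m n hnm i hi j hj => ?_⟩
  · cases m with
    | zero => exact hs2 0 0
    | succ m => exact hs2 (m + 1) (φ m)
  · obtain ⟨m, rfl⟩ : ∃ m', m = m' + 1 := ⟨m - 1, by omega⟩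
    refine (hs3 (m + 1) (φ m) (φ n) (hmono.monotone (by omega)) i hi j hj).trans ?_
    gcongr ?_ * _
    exact pow_le_pow_of_le_one (by norm_num) (by norm_num) hnm.le

/-- If the functions `X k` have pairwise inner products at most `c i * c j` off the diagonal, the
second moments of their partial sums are controlled by those of the individual functions. -/
lemma integral_sum_sq_le_of_almost_orthogonal {Ω : Type*} [MeasurableSpace Ω] {μ : Measure Ω}
    {X : ℕ → Ω → ℝ} (hX : ∀ k, MemLp (X k) 2 μ) {c d : ℕ → ℝ} (hc0 : ∀ k, 0 ≤ c k)
    (hc1 : ∀ k, c k ≤ 1) (hc : Summable c) (hd : ∀ k, ∫ ω, X k ω ^ 2 ∂μ ≤ d k)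
    (h : ∀ i j, i ≠ j → ∫ ω, X i ω * X j ω ∂μ ≤ c i * c j) (N : ℕ) :
    ∫ ω, (∑ k ∈ Finset.range N, X k ω) ^ 2 ∂μ ≤ ∑ k ∈ Finset.range N, (d k + ∑' i, c i) := by
  have hij (i j : ℕ) : Integrable (fun ω => X i ω * X j ω) μ := (hX i).integrable_mul (hX j)
  have hle (i j : ℕ) : ∫ ω, X i ω * X j ω ∂μ ≤ (if i = j then d i else 0) + c i * c j := by
    split_ifs with e
    · subst e
      have := hd i
      simp_rw [sq] at this
      nlinarith [hc0 i]
    · simpa using h i j e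
  simp_rw [sq, Finset.sum_mul_sum]
  rw [integral_finsetSum _ fun i _ => integrable_finsetSum _ fun j _ => hij i j]
  refine Finset.sum_le_sum fun i hi => ?_
  rw [integral_finsetSum _ fun j _ => hij i j]
  refine (Finset.sum_le_sum fun j _ => hle i j).trans ?_
  rw [Finset.sum_add_distrib, Finset.sum_ite_eq, if_pos hi, ← Finset.mul_sum]
  have h1 : ∑ j ∈ Finset.range N, c j ≤ ∑' j, c j := hc.sum_le_tsum _ fun j _ => hc0 j
  have h2 : 0 ≤ ∑ j ∈ Finset.range N, c j := Finset.sum_nonneg fun j _ => hc0 j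
  nlinarith [hc0 i, hc1 i]

/-- Berkes' theorem for nonnegative functions, for arbitrary injective rearrangements. -/
lemma exists_subseq_ae_tendsto_cesaro_of_nonneg
    {Ω : Type*} [MeasurableSpace Ω] (μ : Measure Ω) [IsProbabilityMeasure μ]
    (f : ℕ → Ω → ℝ) (hint : ∀ n, Integrable (f n) μ) (h0 : ∀ n ω, 0 ≤ f n ω)
    {C : ℝ} (hC : ∀ n, ∫ ω, f n ω ∂μ ≤ C) :
    ∃ F : Ω → ℝ, Integrable F μ ∧ ∃ φ : ℕ → ℕ, StrictMono φ ∧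
      ∀ σ : ℕ → ℕ, Function.Injective σ →
        ∀ᵐ ω ∂μ, Tendsto (fun n : ℕ => (∑ k ∈ Finset.range n, f (φ (σ k)) ω) / n)
          atTop (𝓝 (F ω)) := by
  obtain ⟨w, q, φ, hφ, hwL, hw0, hwm, hwC, hqs, hqw, hsq, hortho⟩ :=
    exists_subseq_almost_orthogonal μ f hint h0 hC
  have hwi (k : ℕ) : Integrable (w k) μ := (hwL k).integrable one_le_two
  obtain ⟨F, hF, hwF⟩ := exists_integrable_ae_tendsto_of_monotone hwi hw0 hwm hwC
  refine ⟨F, hF, φ, hφ, fun σ hσ => ?_⟩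
  let t : ℕ → Ω → ℝ := fun k ω => min (f (φ (σ k)) ω) ((k : ℝ) + 1)
  have htL (k : ℕ) : MemLp (t k) 2 μ := memLp_two_min_const (hint _) (h0 _) (by positivity)
  have ht0 (k : ℕ) (ω : Ω) : 0 ≤ t k ω := le_min (h0 _ ω) (by positivity)
  have hq0 (k : ℕ) : 0 ≤ q k := (integral_nonneg fun ω => sq_nonneg _).trans (hqw k)
  have hC0 : 0 ≤ C := (integral_nonneg (h0 0)).trans (hC 0)
  set c : ℕ → ℝ := fun k => (1 / 2) ^ σ k with hcdef
  have hc0 (k : ℕ) : 0 ≤ c k := by positivity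
  have hc1 (k : ℕ) : c k ≤ 1 := pow_le_one₀ (by norm_num) (by norm_num)
  have hc : Summable c := summable_geometric_two.comp_injective hσ
  have hinv : Summable fun k : ℕ => 1 / ((k : ℝ) + 1) ^ 2 := by
    have := (summable_nat_add_iff 1).2 (Real.summable_one_div_nat_pow.2 one_lt_two)
    simpa using this
  have hlin (A B : ℝ) : Summable fun k : ℕ => (A * q k + B) / ((k : ℝ) + 1) ^ 2 := by
    refine ((hqs.mul_left A).add (hinv.mul_left B)).congr fun k => ?_
    ring
  let X : ℕ → Ω → ℝ := fun k ω => if k ≤ 2 ^ σ k then t k ω - w k ω else 0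
  have hXgood {k : ℕ} (hk : k ≤ 2 ^ σ k) : X k = fun ω => t k ω - w k ω := by
    funext ω; exact if_pos hk
  have hXbad {k : ℕ} (hk : ¬ k ≤ 2 ^ σ k) : X k = fun _ => 0 := by
    funext ω; exact if_neg hk
  have hXL (k : ℕ) : MemLp (X k) 2 μ := by
    by_cases hk : k ≤ 2 ^ σ k
    · rw [hXgood hk]; exact (htL k).sub (hwL k)
    · rw [hXbad hk]; exact memLp_const 0
  have hXd (k : ℕ) : ∫ ω, X k ω ^ 2 ∂μ ≤ 4 * q k + 2 := by
    by_cases hk : k ≤ 2 ^ σ k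
    · rw [hXgood hk]
      calc ∫ ω, (t k ω - w k ω) ^ 2 ∂μ ≤ ∫ ω, (2 * t k ω ^ 2 + 2 * w k ω ^ 2) ∂μ := by
            refine integral_mono ((htL k).sub (hwL k)).integrable_sq
              (((htL k).integrable_sq.const_mul 2).add ((hwL k).integrable_sq.const_mul 2))
              fun ω => ?_
            simp only
            linarith [sq_nonneg (t k ω + w k ω), add_sq (t k ω) (w k ω), sub_sq (t k ω) (w k ω)]
        _ = 2 * ∫ ω, t k ω ^ 2 ∂μ + 2 * ∫ ω, w k ω ^ 2 ∂μ := by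
            rw [integral_add ((htL k).integrable_sq.const_mul 2)
              ((hwL k).integrable_sq.const_mul 2), integral_const_mul, integral_const_mul]
        _ ≤ _ := by linarith [hsq (σ k) k hk, hqw k]
    · rw [hXbad hk]
      have := hq0 k
      simp only [ne_eq, OfNat.ofNat_ne_zero, not_false_eq_true, zero_pow, integral_zero]
      linarith
  have hXo (i j : ℕ) (hij : i ≠ j) : ∫ ω, X i ω * X j ω ∂μ ≤ c i * c j := by
    have key {i j : ℕ} (h : σ i < σ j) : ∫ ω, X j ω * X i ω ∂μ ≤ c i * c j := by
      have hpos : 0 ≤ c i * c j := mul_nonneg (hc0 i) (hc0 j)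
      by_cases hi : i ≤ 2 ^ σ i
      · by_cases hj : j ≤ 2 ^ σ j
        · rw [hXgood hi, hXgood hj]
          exact (le_abs_self _).trans (hortho (σ j) (σ i) h i
            (hi.trans (Nat.pow_le_pow_right two_pos h.le)) j hj)
        · rw [hXbad hj]; simpa using hpos
      · rw [hXbad hi]; simpa using hpos
    rcases lt_or_gt_of_ne (hσ.ne hij) with h | h
    · simpa only [mul_comm (X i _)] using key h
    · rw [mul_comm]; exact key h
  have hXlim : ∀ᵐ ω ∂μ, ∀ r : ℕ, Tendsto (fun p : ℕ =>
      (∑ k ∈ Finset.range ⌊(1 + 1 / ((r : ℝ) + 1)) ^ p⌋₊, X k ω) /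
        ⌊(1 + 1 / ((r : ℝ) + 1)) ^ p⌋₊) atTop (𝓝 0) := by
    refine ae_all_iff.2 fun r => ae_tendsto_sum_div_floor_pow hXL
      (b := fun k => 4 * q k + 2 + ∑' i, c i) (fun k => ?_) ?_
      (integral_sum_sq_le_of_almost_orthogonal hXL hc0 hc1 hc hXd hXo) ?_
    · have := hq0 k
      have : 0 ≤ ∑' i, c i := tsum_nonneg hc0
      positivity
    · simpa only [add_assoc] using hlin 4 (2 + ∑' i, c i)
    · have : 0 < 1 / ((r : ℝ) + 1) := by positivity
      linarith
  have hgood : ∀ᵐ ω ∂μ, Summable fun k =>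
      if k ≤ 2 ^ σ k then t k ω ^ 2 / ((k : ℝ) + 1) ^ 2 else 0 := by
    refine ae_summable_of_summable_integral (fun k => ?_) (fun k => ?_)
      ((hlin 1 1).of_nonneg_of_le (fun k => integral_nonneg fun ω => ?_) fun k => ?_)
    · split_ifs
      · exact (htL k).integrable_sq.div_const _
      · exact integrable_zero _ _ _
    · refine Eventually.of_forall fun ω => ?_
      simp only [Pi.zero_apply]
      split_ifs <;> positivity
    · simp only [Pi.zero_apply]
      split_ifs <;> positivity
    · have := hq0 k
      split_ifs with hk
      · rw [integral_div]
        gcongr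
        linarith [hsq (σ k) k hk]
      · simp only [integral_zero]; positivity
  have hbad : ∀ᵐ ω ∂μ, Summable fun k =>
      if k ≤ 2 ^ σ k then 0 else (f (φ (σ k)) ω + w k ω) / ((k : ℝ) + 1) := by
    have hnn (k : ℕ) : 0 ≤ᵐ[μ] fun ω =>
        if k ≤ 2 ^ σ k then 0 else (f (φ (σ k)) ω + w k ω) / ((k : ℝ) + 1) := by
      filter_upwards [hw0 k] with ω hω
      have h1 := h0 (φ (σ k)) ω
      simp only [Pi.zero_apply] at hω ⊢
      split_ifs <;> positivity
    refine ae_summable_of_summable_integral (fun k => ?_) hnn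
      ((hc.mul_left (2 * C)).of_nonneg_of_le (fun k => integral_nonneg_of_ae (hnn k)) fun k => ?_)
    · split_ifs
      · exact integrable_zero _ _ _
      · exact ((hint _).add (hwi k)).div_const _
    · have := hc0 k
      split_ifs with hk
      · simp only [integral_zero]; positivity
      · rw [integral_div, integral_add (hint _) (hwi k), div_eq_mul_inv]
        have hk' : (2 : ℝ) ^ σ k ≤ (k : ℝ) + 1 := by
          have : 2 ^ σ k ≤ k + 1 := by omega
          exact_mod_cast this
        have h1 : ((k : ℝ) + 1)⁻¹ ≤ c k := by
          rw [hcdef]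
          simp only [one_div, inv_pow]
          gcongr
        refine mul_le_mul (by linarith [hC (φ (σ k)), hwC k]) h1 (by positivity) (by positivity)
  filter_upwards [hwF, hXlim, hgood, hbad, ae_all_iff.2 hw0] with ω hwω hXω hgω hbω hw0ω
  have hY0 (k : ℕ) : 0 ≤ X k ω + w k ω := by
    by_cases hk : k ≤ 2 ^ σ k
    · simpa [hXgood hk] using ht0 k ω
    · simpa [hXbad hk] using hw0ω k
  have hwces : Tendsto (fun n : ℕ => (∑ k ∈ Finset.range n, w k ω) / n) atTop (𝓝 (F ω)) :=
    hwω.cesaro.congr fun n => by rw [div_eq_inv_mul]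
  have hY : Tendsto (fun n : ℕ => (∑ k ∈ Finset.range n, (X k ω + w k ω)) / n) atTop
      (𝓝 (F ω)) := by
    refine tendsto_div_of_monotone_of_tendsto_div_floor_pow _ _
      (monotone_nat_of_le_succ fun n => ?_) (fun r : ℕ => 1 + 1 / ((r : ℝ) + 1)) (fun r => ?_) ?_
      fun r => ?_
    · rw [Finset.sum_range_succ]; linarith [hY0 n]
    · have : 0 < 1 / ((r : ℝ) + 1) := by positivity
      linarith
    · simpa using tendsto_one_div_add_atTop_nhds_zero_nat.const_add (1 : ℝ)
    · have hr : 1 < 1 + 1 / ((r : ℝ) + 1) := by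
        have : 0 < 1 / ((r : ℝ) + 1) := by positivity
        linarith
      have h1 := (hXω r).add (hwces.comp
        (tendsto_nat_floor_atTop.comp (tendsto_pow_atTop_atTop_of_one_lt hr)))
      rw [zero_add] at h1
      refine h1.congr fun p => ?_
      simp only [Function.comp_apply]
      rw [Finset.sum_add_distrib, add_div]
  have hD : Tendsto (fun n : ℕ =>
      (∑ k ∈ Finset.range n, (f (φ (σ k)) ω - (X k ω + w k ω))) / n) atTop (𝓝 0) := by
    refine tendsto_sum_div_of_summable_div (Summable.of_norm_bounded_eventually_nat hbω ?_)
    filter_upwards [hgω.tendsto_atTop_zero.eventually_lt_const one_pos] with k hk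
    rw [Real.norm_of_nonneg (by positivity)]
    by_cases hkg : k ≤ 2 ^ σ k
    · rw [if_pos hkg, div_lt_one (by positivity)] at hk
      have h1 : t k ω < (k : ℝ) + 1 := lt_of_pow_lt_pow_left₀ 2 (by positivity) hk
      have h2 : t k ω = f (φ (σ k)) ω := by
        rcases min_lt_iff.1 h1 with h | h
        · exact min_eq_left h.le
        · exact absurd h (lt_irrefl _)
      rw [if_pos hkg, hXgood hkg]
      simp [h2]
    · have h1 := h0 (φ (σ k)) ω
      have h2 : 0 ≤ w k ω := hw0ω k
      rw [if_neg hkg, hXbad hkg, zero_add]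
      gcongr
      rw [abs_le]
      constructor <;> linarith
  have := hY.add hD
  rw [add_zero] at this
  refine this.congr fun n => ?_
  rw [← add_div, ← Finset.sum_add_distrib]
  simp

/-- Berkes' theorem: every `L¹`-bounded sequence of integrable real functions has a
subsequence `g` such that the Cesàro means of every permutation of `g` converge a.e.
to a fixed integrable function `F`. -/
theorem berkes
    {Ω : Type*} [MeasurableSpace Ω] (μ : Measure Ω) [IsProbabilityMeasure μ]
    (f : ℕ → Ω → ℝ) (hint : ∀ n, Integrable (f n) μ)
    (hbd : ∃ C : ℝ, ∀ n, ∫ ω, |f n ω| ∂μ ≤ C) :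
    ∃ (F : Ω → ℝ), Integrable F μ ∧ ∃ φ : ℕ → ℕ, StrictMono φ ∧
      ∀ π : ℕ → ℕ, Function.Bijective π →
        ∀ᵐ ω ∂μ, Tendsto
          (fun n : ℕ => (∑ k ∈ Finset.range n, f (φ (π k)) ω) / n)
          atTop (𝓝 (F ω)) := by
  obtain ⟨C, hC⟩ := hbd
  obtain ⟨F₁, hF₁, φ₁, hφ₁, h₁⟩ := exists_subseq_ae_tendsto_cesaro_of_nonneg μ
    (fun n ω => max (f n ω) 0) (fun n => (hint n).pos_part) (fun n ω => le_max_right _ _)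
    (C := C) fun n => (integral_mono (hint n).pos_part (hint n).abs fun ω =>
      max_le (le_abs_self _) (abs_nonneg _)).trans (hC n)
  obtain ⟨F₂, hF₂, φ₂, hφ₂, h₂⟩ := exists_subseq_ae_tendsto_cesaro_of_nonneg μ
    (fun n ω => max (-f (φ₁ n) ω) 0) (fun n => (hint _).neg_part) (fun n ω => le_max_right _ _)
    (C := C) fun n => (integral_mono (hint _).neg_part (hint _).abs fun ω =>
      max_le (neg_le_abs _) (abs_nonneg _)).trans (hC (φ₁ n))
  refine ⟨F₁ - F₂, hF₁.sub hF₂, φ₁ ∘ φ₂, hφ₁.comp hφ₂, fun π hπ => ?_⟩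
  filter_upwards [h₁ (φ₂ ∘ π) (hφ₂.injective.comp hπ.injective), h₂ π hπ.injective] with ω ha hb
  refine (ha.sub hb).congr fun n => ?_
  rw [← sub_div, ← Finset.sum_sub_distrib]
  congr 1
  refine Finset.sum_congr rfl fun k _ => ?_
  simp only [Function.comp_apply]
  rcases le_total 0 (f (φ₁ (φ₂ (π k))) ω) with h | h <;> simp [h]
end
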